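/- arXiv:1804.07076 — 2 statements merged into one kernel-verified Lean document; each statement's English description precedes it below -/
import Mathlib

section
/- For all real α, β > −1 and every δ ∈ (0, π/2) there exist constants C > 0 and N ∈ ℕ such that for all n ≥ N and all θ ∈ [δ, π−δ], writing κ = n + (α+β+1)/2 and χ = κθ − (α/2 + 1/4)π, one has |√(πκ) · (sin(θ/2))^{α+1/2} (cos(θ/2))^{β+1/2} · P_n^{(α,β)}(cos θ) − cos χ| ≤ C/κ. -/
open Real

/-- The Jacobi polynomial `P_n^{(α,β)}(x)` defined by its explicit sum. -/
noncomputable def jacobiP (α β : ℝ) (n : ℕ) (x : ℝ) : ℝ :=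
  ∑ ℓ ∈ Finset.range (n + 1),
    ((ascPochhammer ℝ ℓ).eval ((n : ℝ) + α + β + 1) *
        (ascPochhammer ℝ (n - ℓ)).eval (α + (ℓ : ℝ) + 1)) /
      ((Nat.factorial ℓ : ℝ) * (Nat.factorial (n - ℓ) : ℝ)) * ((x - 1) / 2) ^ ℓ

theorem ascPochhammer_eval_div_factorial (r : ℝ) (k : ℕ) :
    (ascPochhammer ℝ k).eval r / (k.factorial : ℝ) = Ring.choose (r + k - 1) k := by
  rw [← Ring.multichoose_eq, ← Polynomial.ascPochhammer_smeval_eq_eval,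
    ← Ring.factorial_nsmul_multichoose_eq_ascPochhammer, nsmul_eq_mul,
    mul_div_cancel_left₀ _ (by positivity)]

theorem jacobiP_eq_sum_choose (α β : ℝ) (n : ℕ) (x : ℝ) :
    jacobiP α β n x = ∑ ℓ ∈ Finset.range (n + 1),
      Ring.choose (n + α) (n - ℓ) * Ring.choose (α + β + n + ℓ) ℓ * ((x - 1) / 2) ^ ℓ := by
  refine Finset.sum_congr rfl fun ℓ hℓ => ?_
  have hle : ℓ ≤ n := Nat.lt_succ_iff.mp (Finset.mem_range.mp hℓ)
  rw [mul_comm (ℓ.factorial : ℝ), mul_comm ((ascPochhammer ℝ ℓ).eval _), mul_div_mul_comm,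
    ascPochhammer_eval_div_factorial, ascPochhammer_eval_div_factorial]
  push_cast [hle]
  ring_nf

theorem sum_choose_mul_choose_mul_pow (a b y : ℝ) (n : ℕ) :
    ∑ ℓ ∈ Finset.range (n + 1),
        Ring.choose a (n - ℓ) * Ring.choose (b + (a - (n - ℓ : ℕ))) ℓ * y ^ ℓ =
      ∑ k ∈ Finset.range (n + 1),
        Ring.choose a (n - k) * Ring.choose b k * (y ^ k * (1 + y) ^ (n - k)) := by
  have hl : ∀ ℓ ∈ Finset.range (n + 1),
      Ring.choose a (n - ℓ) * Ring.choose (b + (a - (n - ℓ : ℕ))) ℓ * y ^ ℓ =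
        ∑ k ∈ Finset.range (ℓ + 1),
          (n - k).choose (n - ℓ) * Ring.choose a (n - k) * Ring.choose b k * y ^ ℓ := by
    intro ℓ hℓ
    have hle : ℓ ≤ n := Nat.lt_succ_iff.mp (Finset.mem_range.mp hℓ)
    rw [Ring.add_choose_eq _ (Commute.all _ _), Finset.Nat.sum_antidiagonal_eq_sum_range_succ_mk,
      Finset.mul_sum, Finset.sum_mul]
    refine Finset.sum_congr rfl fun k hk => ?_
    have hk' : k ≤ ℓ := Nat.lt_succ_iff.mp (Finset.mem_range.mp hk)
    have h := Ring.choose_smul_choose a (show n - ℓ ≤ n - k by omega)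
    rw [nsmul_eq_mul, show n - k - (n - ℓ) = ℓ - k by omega] at h
    rw [h]; ring
  have hr : ∀ k ∈ Finset.range (n + 1),
      Ring.choose a (n - k) * Ring.choose b k * (y ^ k * (1 + y) ^ (n - k)) =
        ∑ ℓ ∈ Finset.Ico k (n + 1),
          (n - k).choose (n - ℓ) * Ring.choose a (n - k) * Ring.choose b k * y ^ ℓ := by
    intro k hk
    have hle : k ≤ n := Nat.lt_succ_iff.mp (Finset.mem_range.mp hk)
    rw [add_comm 1 y, add_pow, Finset.sum_Ico_eq_sum_range, Finset.mul_sum, Finset.mul_sum,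
      show n + 1 - k = n - k + 1 by omega]
    refine Finset.sum_congr rfl fun m hm => ?_
    have hm' : m ≤ n - k := Nat.lt_succ_iff.mp (Finset.mem_range.mp hm)
    rw [show n - (k + m) = n - k - m by omega, Nat.choose_symm hm', pow_add, one_pow]
    ring
  rw [Finset.sum_congr rfl hl, Finset.sum_congr rfl hr]
  refine Finset.sum_comm' fun ℓ k => ?_
  simp only [Finset.mem_range, Finset.mem_Ico]
  omega

/-- At `0` the Jacobi polynomial is, up to `2 ^ n`, a Taylor coefficient of
`(1 + w) ^ (n + α) * (1 - w) ^ (n + β)`. -/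
theorem jacobiP_zero (α β : ℝ) (n : ℕ) :
    jacobiP α β n 0 = (2 ^ n)⁻¹ * ∑ p ∈ Finset.HasAntidiagonal.antidiagonal n,
      Ring.choose (n + α) p.1 * (Ring.choose (n + β) p.2 * (-1) ^ p.2) := by
  have h := sum_choose_mul_choose_mul_pow (n + α) (n + β) (-1 / 2) n
  rw [← Finset.Nat.sum_antidiagonal_swap, Finset.Nat.sum_antidiagonal_eq_sum_range_succ_mk,
    jacobiP_eq_sum_choose, Finset.mul_sum]
  simp only [Prod.swap]
  calc _ = _ := Finset.sum_congr rfl fun ℓ hℓ => ?_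
    _ = _ := h
    _ = _ := Finset.sum_congr rfl fun k hk => ?_
  · have hle : ℓ ≤ n := Nat.lt_succ_iff.mp (Finset.mem_range.mp hℓ)
    push_cast [hle]
    ring_nf
  · have hle : k ≤ n := Nat.lt_succ_iff.mp (Finset.mem_range.mp hk)
    have h2 : ((-1 : ℝ) / 2) ^ k * (1 + -1 / 2) ^ (n - k) = (2 ^ n)⁻¹ * (-1) ^ k := by
      rw [show (1 : ℝ) + -1 / 2 = 1 / 2 by norm_num, div_pow, div_pow, one_pow,
        show (2 : ℝ) ^ n = 2 ^ k * 2 ^ (n - k) by rw [← pow_add]; congr 1; omega]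
      field_simp
    rw [h2]; ring

theorem summable_norm_choose_mul_pow (a : ℂ) {w : ℂ} (hw : ‖w‖ < 1) :
    Summable fun n => ‖Ring.choose a n * w ^ n‖ := by
  have h : w ∈ Metric.eball (0 : ℂ) (binomialSeries ℂ a).radius := by
    refine Metric.eball_subset_eball (binomialSeries_radius_ge_one (𝔸 := ℂ) (a := a)) ?_
    simpa [Metric.mem_eball, edist_zero_right, enorm_eq_nnnorm, ← NNReal.coe_lt_coe] using hw
  simpa [binomialSeries, mul_comm] using (binomialSeries ℂ a).summable_norm_apply h

theorem hasSum_choose_mul_pow (a : ℂ) {w : ℂ} (hw : ‖w‖ < 1) :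
    HasSum (fun n => Ring.choose a n * w ^ n) ((1 + w) ^ a) := by
  have h : w ∈ Metric.eball (0 : ℂ) 1 := by
    simpa [Metric.mem_eball, edist_zero_right, enorm_eq_nnnorm, ← NNReal.coe_lt_coe] using hw
  simpa [binomialSeries, mul_comm] using
    (Complex.one_add_cpow_hasFPowerSeriesOnBall_zero (a := a)).hasSum h

theorem hasFPowerSeriesAt_one_add_cpow_mul_one_sub_cpow (a b : ℂ) :
    HasFPowerSeriesAt (fun w : ℂ => (1 + w) ^ a * (1 - w) ^ b)
      (FormalMultilinearSeries.ofScalars ℂ fun n => ∑ p ∈ Finset.HasAntidiagonal.antidiagonal n,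
        Ring.choose a p.1 * (Ring.choose b p.2 * (-1) ^ p.2)) 0 := by
  have key : ∀ w : ℂ, ∀ n, ∑ p ∈ Finset.HasAntidiagonal.antidiagonal n,
        (Ring.choose a p.1 * w ^ p.1) * (Ring.choose b p.2 * (-w) ^ p.2) =
      (∑ p ∈ Finset.HasAntidiagonal.antidiagonal n,
        Ring.choose a p.1 * (Ring.choose b p.2 * (-1) ^ p.2)) * w ^ n := by
    intro w n
    rw [Finset.sum_mul]
    refine Finset.sum_congr rfl fun p hp => ?_
    rw [← Finset.HasAntidiagonal.mem_antidiagonal.mp hp, pow_add, neg_pow w]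
    ring
  refine ⟨((1 / 2 : NNReal) : ENNReal), ?_, by simp, ?_⟩
  · refine FormalMultilinearSeries.le_radius_of_summable_norm _ ?_
    have hw : ‖(1 / 2 : ℂ)‖ < 1 := by norm_num
    have := summable_norm_sum_mul_antidiagonal_of_summable_norm
      (summable_norm_choose_mul_pow a hw)
      (summable_norm_choose_mul_pow b (w := -(1 / 2)) (by rwa [norm_neg]))
    simp only [key] at this
    refine this.congr fun n => ?_
    simp
  · intro w hw
    have hw : ‖w‖ < 1 := by
      have : ‖w‖₊ < 1 / 2 := by
        rwa [Metric.mem_eball, edist_zero_right, enorm_eq_nnnorm, ENNReal.coe_lt_coe] at hw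
      have : ‖w‖ < 1 / 2 := by exact_mod_cast this
      linarith
    have hw' : ‖-w‖ < 1 := by rwa [norm_neg]
    have h := (hasSum_choose_mul_pow a hw).tsum_eq
    have h' := (hasSum_choose_mul_pow b hw').tsum_eq
    have hs := summable_norm_sum_mul_antidiagonal_of_summable_norm
      (summable_norm_choose_mul_pow a hw) (summable_norm_choose_mul_pow b hw')
    have ht := tsum_mul_tsum_eq_tsum_sum_antidiagonal_of_summable_norm
      (summable_norm_choose_mul_pow a hw) (summable_norm_choose_mul_pow b hw')
    have := hs.of_norm.hasSum
    rw [← ht, h, h'] at this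
    simp only [key] at this
    simpa [mul_comm (w ^ _), sub_eq_add_neg] using this

theorem diffContOnCl_one_add_cpow_mul_one_sub_cpow {a b : ℝ} (ha : 0 < a) (hb : 0 < b) :
    DiffContOnCl ℂ (fun w : ℂ => (1 + w) ^ (a : ℂ) * (1 - w) ^ (b : ℂ)) (Metric.ball 0 1) := by
  refine ⟨fun w hw => ?_, fun w hw => ?_⟩
  · have hw : ‖w‖ < 1 := by simpa using hw
    have h1 := (abs_lt.mp ((Complex.abs_re_le_norm w).trans_lt hw))
    refine DifferentiableAt.differentiableWithinAt ?_
    refine (DifferentiableAt.cpow_const (by fun_prop) ?_).mul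
      (DifferentiableAt.cpow_const (by fun_prop) ?_)
    · left; simp; linarith
    · left; simp; linarith
  · rw [closure_ball _ one_ne_zero] at hw
    have hw : ‖w‖ ≤ 1 := by simpa using hw
    have h1 := (abs_le.mp ((Complex.abs_re_le_norm w).trans hw))
    refine ContinuousAt.continuousWithinAt ?_
    refine ContinuousAt.mul ?_ ?_
    · refine ContinuousAt.comp (f := fun w : ℂ => 1 + w) (g := fun z : ℂ => z ^ (a : ℂ))
        (Complex.continuousAt_cpow_const_of_re_pos (Or.inl ?_) (by simpa)) (by fun_prop)
      simp; linarith
    · refine ContinuousAt.comp (f := fun w : ℂ => 1 - w) (g := fun z : ℂ => z ^ (b : ℂ))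
        (Complex.continuousAt_cpow_const_of_re_pos (Or.inl ?_) (by simpa)) (by fun_prop)
      simp; linarith

theorem sum_choose_mul_choose_eq_integral {a b : ℝ} (ha : 0 < a) (hb : 0 < b) (n : ℕ) :
    ((∑ p ∈ Finset.HasAntidiagonal.antidiagonal n,
        Ring.choose a p.1 * (Ring.choose b p.2 * (-1) ^ p.2) : ℝ) : ℂ) =
      (2 * π : ℂ)⁻¹ * ∫ φ in (0 : ℝ)..2 * π,
        (1 + Complex.exp (φ * Complex.I)) ^ (a : ℂ) * (1 - Complex.exp (φ * Complex.I)) ^ (b : ℂ) *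
          Complex.exp (-(n * φ * Complex.I)) := by
  have h1 := hasFPowerSeriesAt_one_add_cpow_mul_one_sub_cpow a b
  have h2 := ((diffContOnCl_one_add_cpow_mul_one_sub_cpow ha hb).hasFPowerSeriesOnBall (R := 1)
    one_pos).hasFPowerSeriesAt
  have h := congrArg (fun p : FormalMultilinearSeries ℂ ℂ ℂ => p n fun _ => (1 : ℂ))
    (h1.eq_formalMultilinearSeries h2)
  simp only [cauchyPowerSeries_apply, FormalMultilinearSeries.ofScalars_apply_eq] at h
  have hc : ∀ (c : ℝ) (k : ℕ), ((Ring.choose c k : ℝ) : ℂ) = Ring.choose (c : ℂ) k := fun c k =>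
    Ring.map_choose Complex.ofRealHom c k
  push_cast [hc]
  simp only [one_pow, smul_eq_mul, mul_one] at h
  rw [h, circleIntegral, mul_inv, mul_inv, mul_assoc _ Complex.I⁻¹, ← mul_inv,
    ← intervalIntegral.integral_const_mul]
  congr 1
  refine intervalIntegral.integral_congr fun φ _ => ?_
  have he : Complex.exp (φ * Complex.I) ≠ 0 := Complex.exp_ne_zero _
  simp only [deriv_circleMap, circleMap, Complex.ofReal_one, NNReal.coe_one, one_mul, zero_add,
    sub_zero, smul_eq_mul]
  rw [Complex.exp_neg, mul_assoc (n : ℂ), Complex.exp_nat_mul, one_div,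
    inv_pow]
  field_simp

theorem ofReal_mul_exp_cpow {r θ a : ℝ} (hr : 0 ≤ r) (hθ : θ ∈ Set.Ioc (-π) π) (ha : a ≠ 0) :
    ((r : ℂ) * Complex.exp (θ * Complex.I)) ^ (a : ℂ) =
      ((r ^ a : ℝ) : ℂ) * Complex.exp ((a * θ : ℝ) * Complex.I) := by
  rcases hr.eq_or_lt with rfl | hr
  · simp [ha, Real.zero_rpow]
  · rw [Complex.cpow_def_of_ne_zero
        (mul_ne_zero (by exact_mod_cast hr.ne') (Complex.exp_ne_zero _)),
      Complex.log_ofReal_mul hr (Complex.exp_ne_zero _),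
      Complex.log_exp (by simpa using hθ.1) (by simpa using hθ.2), Real.rpow_def_of_pos hr,
      add_mul, Complex.exp_add]
    push_cast
    congr 2
    ring

theorem one_add_exp_two_mul (ψ : ℝ) :
    1 + Complex.exp ((2 * ψ : ℝ) * Complex.I) =
      ((2 * cos ψ : ℝ) : ℂ) * Complex.exp (ψ * Complex.I) := by
  rw [Complex.exp_mul_I, Complex.exp_mul_I]
  push_cast
  rw [Complex.cos_two_mul, Complex.sin_two_mul]
  ring

theorem one_sub_exp_two_mul (ψ : ℝ) :
    1 - Complex.exp ((2 * ψ : ℝ) * Complex.I) =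
      ((2 * sin ψ : ℝ) : ℂ) * Complex.exp ((ψ - π / 2 : ℝ) * Complex.I) := by
  have h := Complex.sin_sq_add_cos_sq ψ
  rw [Complex.exp_mul_I, Complex.exp_mul_I, ← Complex.ofReal_cos, ← Complex.ofReal_sin,
    ← Complex.ofReal_cos, ← Complex.ofReal_sin, cos_two_mul, sin_two_mul, cos_sub_pi_div_two,
    sin_sub_pi_div_two]
  push_cast
  linear_combination (-2) * h

theorem conj_one_add_cpow {z : ℂ} (hz : ‖z‖ ≤ 1) (a : ℝ) :
    (1 + (starRingEnd ℂ) z) ^ (a : ℂ) = (starRingEnd ℂ) ((1 + z) ^ (a : ℂ)) := by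
  have h1 := (abs_le.mp ((Complex.abs_re_le_norm z).trans hz))
  have harg : (1 + z).arg ≠ π := by
    rw [Ne, Complex.arg_eq_pi_iff]
    rintro ⟨h, -⟩
    simp at h
    linarith
  have := Complex.conj_cpow (1 + z) (a : ℂ) harg
  simpa using this

theorem integral_two_pi_eq_of_symm {r : ℝ → ℝ} (hr : Continuous r)
    (hs : ∀ φ, r (2 * π - φ) = r φ) :
    ∫ φ in (0 : ℝ)..2 * π, r φ = 4 * ∫ ψ in (0 : ℝ)..π / 2, r (2 * ψ) := by
  have h2 : ∫ φ in π..2 * π, r φ = ∫ φ in (0 : ℝ)..π, r φ := by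
    have := intervalIntegral.integral_comp_sub_left (a := 0) (b := π) r (2 * π)
    simp only [hs] at this
    rw [this]
    congr 1 <;> ring
  rw [← intervalIntegral.integral_add_adjacent_intervals (hr.intervalIntegrable 0 π)
    (hr.intervalIntegrable π (2 * π)), h2, intervalIntegral.integral_comp_mul_left r two_ne_zero]
  rw [mul_zero, mul_div_cancel₀ π two_ne_zero, smul_eq_mul]
  ring

theorem continuous_circle_integrand {a b : ℝ} (ha : 0 < a) (hb : 0 < b) (n : ℕ) :
    Continuous fun φ : ℝ => (1 + Complex.exp (φ * Complex.I)) ^ (a : ℂ) *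
      (1 - Complex.exp (φ * Complex.I)) ^ (b : ℂ) * Complex.exp (-(n * φ * Complex.I)) := by
  have h1 : ∀ φ : ℝ, |(Complex.exp (φ * Complex.I)).re| ≤ 1 := fun φ =>
    (Complex.abs_re_le_norm _).trans (Complex.norm_exp_ofReal_mul_I φ).le
  refine Continuous.mul (Continuous.mul ?_ ?_) (by fun_prop)
  · refine continuous_iff_continuousAt.mpr fun φ => ?_
    refine ContinuousAt.comp (f := fun φ : ℝ => 1 + Complex.exp (φ * Complex.I))
      (g := fun z : ℂ => z ^ (a : ℂ))
      (Complex.continuousAt_cpow_const_of_re_pos (Or.inl ?_) (by simpa)) (by fun_prop)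
    have := abs_le.mp (h1 φ)
    rw [Complex.add_re, Complex.one_re]; linarith
  · refine continuous_iff_continuousAt.mpr fun φ => ?_
    refine ContinuousAt.comp (f := fun φ : ℝ => 1 - Complex.exp (φ * Complex.I))
      (g := fun z : ℂ => z ^ (b : ℂ))
      (Complex.continuousAt_cpow_const_of_re_pos (Or.inl ?_) (by simpa)) (by fun_prop)
    have := abs_le.mp (h1 φ)
    rw [Complex.sub_re, Complex.one_re]; linarith

theorem integral_circle_eq_integral_trig {a b : ℝ} (ha : 0 < a) (hb : 0 < b) (n : ℕ) :
    (∫ φ in (0 : ℝ)..2 * π,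
        (1 + Complex.exp (φ * Complex.I)) ^ (a : ℂ) * (1 - Complex.exp (φ * Complex.I)) ^ (b : ℂ) *
          Complex.exp (-(n * φ * Complex.I))).re =
      4 * ∫ ψ in (0 : ℝ)..π / 2,
        (2 * cos ψ) ^ a * (2 * sin ψ) ^ b * cos (a * ψ + b * (ψ - π / 2) - 2 * n * ψ) := by
  have hg := continuous_circle_integrand ha hb n
  have hre := Complex.reCLM.intervalIntegral_comp_comm (μ := MeasureTheory.volume)
    (hg.intervalIntegrable 0 (2 * π))
  simp only [Complex.reCLM_apply] at hre
  rw [← hre]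
  refine (integral_two_pi_eq_of_symm (Complex.continuous_re.comp hg) ?_).trans ?_
  rotate_left
  · congr 1
    refine intervalIntegral.integral_congr fun ψ hψ => ?_
    rw [Set.uIcc_of_le (by positivity)] at hψ
    have hc : 0 ≤ cos ψ := cos_nonneg_of_mem_Icc ⟨by linarith [hψ.1, pi_pos], hψ.2⟩
    have hs : 0 ≤ sin ψ := sin_nonneg_of_nonneg_of_le_pi hψ.1 (by linarith [hψ.2, pi_pos])
    simp only [Function.comp]
    rw [one_add_exp_two_mul, one_sub_exp_two_mul,
      ofReal_mul_exp_cpow (by positivity) ⟨by linarith [hψ.1, pi_pos], by linarith [hψ.2, pi_pos]⟩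
        ha.ne',
      ofReal_mul_exp_cpow (by positivity) ⟨by linarith [hψ.1, pi_pos], by linarith [hψ.2, pi_pos]⟩
        hb.ne', mul_mul_mul_comm, mul_assoc, ← Complex.exp_add, ← Complex.exp_add,
      ← Complex.ofReal_mul, Complex.re_ofReal_mul,
      ← Complex.exp_ofReal_mul_I_re (a * ψ + b * (ψ - π / 2) - 2 * n * ψ)]
    congr 3
    push_cast
    ring
  · intro φ
    simp only [Function.comp]
    have hz : Complex.exp ((2 * π - φ : ℝ) * Complex.I) =
        (starRingEnd ℂ) (Complex.exp (φ * Complex.I)) := by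
      rw [← Complex.exp_conj, map_mul, Complex.conj_ofReal, Complex.conj_I,
        Complex.exp_eq_exp_iff_exists_int]
      exact ⟨1, by push_cast; ring⟩
    have hn : Complex.exp (-(n * (2 * π - φ : ℝ) * Complex.I)) =
        (starRingEnd ℂ) (Complex.exp (-(n * φ * Complex.I))) := by
      rw [← Complex.exp_conj, map_neg, map_mul, map_mul, Complex.conj_ofReal, Complex.conj_I,
        Complex.conj_natCast, Complex.exp_eq_exp_iff_exists_int]
      exact ⟨-n, by push_cast; ring⟩
    have hnorm : ‖Complex.exp (φ * Complex.I)‖ ≤ 1 := (Complex.norm_exp_ofReal_mul_I φ).le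
    have hsub := conj_one_add_cpow (z := -Complex.exp (φ * Complex.I)) (by rwa [norm_neg]) b
    rw [map_neg, ← sub_eq_add_neg, ← sub_eq_add_neg] at hsub
    rw [hz, hn, conj_one_add_cpow hnorm, hsub, ← map_mul, ← map_mul, Complex.conj_re]

theorem exists_abs_add_sub_two_mul_le {f : ℝ → ℝ} (hf : ContDiff ℝ 2 f) (c : ℝ) {r : ℝ}
    (hr : 0 ≤ r) :
    ∃ K, 0 ≤ K ∧ ∀ t, |t| ≤ r → |f (c + t) + f (c - t) - 2 * f c| ≤ K * t ^ 2 := by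
  set h : ℝ → ℝ := fun t => f (c + t) + f (c - t) with h_def
  have hh : ContDiff ℝ 2 h := by fun_prop
  rcases hr.eq_or_lt with rfl | hr
  · refine ⟨0, le_rfl, fun t ht => ?_⟩
    have : t = 0 := by simpa using ht
    subst this
    simp only [add_zero, sub_zero]
    rw [show f c + f c - 2 * f c = 0 by ring]; simp
  have hd : deriv h 0 = 0 := by
    have h1 : DifferentiableAt ℝ f c := (hf.differentiable (by norm_num)) c
    have h2 : HasDerivAt h (deriv f c + -deriv f c) 0 := by
      refine HasDerivAt.add ?_ ?_
      · refine HasDerivAt.comp_const_add c 0 ?_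
        simpa using h1.hasDerivAt
      · refine HasDerivAt.comp_const_sub c 0 ?_
        simpa using h1.hasDerivAt
    rw [h2.deriv]; ring
  obtain ⟨K, hK⟩ := exists_taylor_mean_remainder_bound (n := 1) hr.le
    (f := h) (by norm_num; exact hh.contDiffOn)
  have hw : derivWithin h (Set.Icc 0 r) 0 = 0 := by
    rw [((hh.differentiable (by norm_num)) 0).derivWithin
      (uniqueDiffOn_Icc hr 0 ⟨le_rfl, hr.le⟩), hd]
  have key : ∀ t, 0 ≤ t → t ≤ r → |f (c + t) + f (c - t) - 2 * f c| ≤ |K| * t ^ 2 := by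
    intro t h0 h1
    have := hK t ⟨h0, h1⟩
    rw [taylorWithinEval_succ, taylor_within_zero_eval, iteratedDerivWithin_one, hw] at this
    norm_num at this
    refine le_trans (le_of_eq ?_) (this.trans
      (mul_le_mul_of_nonneg_right (le_abs_self K) (sq_nonneg t)))
    simp only [h_def, add_zero, sub_zero]
    congr 1
    ring
  refine ⟨|K|, abs_nonneg K, fun t ht => ?_⟩
  rcases le_total 0 t with h0 | h0
  · exact key t h0 (by rwa [abs_of_nonneg h0] at ht)
  · have := key (-t) (by linarith) (by rwa [abs_of_nonpos h0] at ht)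
    rw [← sub_eq_add_neg, sub_neg_eq_add, neg_sq, add_comm (f _)] at this
    exact this

theorem integral_sin_two_mul_pow (m : ℕ) :
    ∫ ψ in (0 : ℝ)..π / 2, sin (2 * ψ) ^ m = (∫ x in (0 : ℝ)..π, sin x ^ m) / 2 := by
  rw [intervalIntegral.integral_comp_mul_left (fun x => sin x ^ m) two_ne_zero, mul_zero,
    mul_div_cancel₀ π two_ne_zero, smul_eq_mul]
  ring

theorem integral_sin_two_mul_pow_mul_cos_sq (m : ℕ) :
    ∫ ψ in (0 : ℝ)..π / 2, sin (2 * ψ) ^ m * cos (2 * ψ) ^ 2 =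
      (∫ x in (0 : ℝ)..π, sin x ^ m) / (2 * (m + 2)) := by
  have h : ∀ ψ : ℝ, sin (2 * ψ) ^ m * cos (2 * ψ) ^ 2 =
      sin (2 * ψ) ^ m - sin (2 * ψ) ^ (m + 2) := fun ψ => by rw [cos_sq']; ring
  simp only [h]
  rw [intervalIntegral.integral_sub (Continuous.intervalIntegrable (by fun_prop) _ _)
    (Continuous.intervalIntegrable (by fun_prop) _ _), integral_sin_two_mul_pow,
    integral_sin_two_mul_pow, integral_sin_pow]
  have : (m : ℝ) + 2 ≠ 0 := by positivity
  field_simp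
  simp
  ring

/-- The Laplace method for `∫ sin (2 * ψ) ^ m * f ψ` around the maximum at `π / 4`. -/
theorem exists_abs_integral_sin_two_mul_pow_mul_sub_le {f : ℝ → ℝ} (hf : ContDiff ℝ 2 f) :
    ∃ K, 0 ≤ K ∧ ∀ m : ℕ,
      |(∫ ψ in (0 : ℝ)..π / 2, sin (2 * ψ) ^ m * f ψ) -
          f (π / 4) * ((∫ x in (0 : ℝ)..π, sin x ^ m) / 2)| ≤
        K / (m + 2) * ∫ x in (0 : ℝ)..π, sin x ^ m := by
  obtain ⟨K, hK0, hK⟩ := exists_abs_add_sub_two_mul_le hf (π / 4) (r := π / 4) (by positivity)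
  have hfc := hf.continuous
  refine ⟨K * (π ^ 2 / 16) / 4, by positivity, fun m => ?_⟩
  have hrefl : ∫ ψ in (0 : ℝ)..π / 2, sin (2 * ψ) ^ m * f (π / 2 - ψ) =
      ∫ ψ in (0 : ℝ)..π / 2, sin (2 * ψ) ^ m * f ψ := by
    have := intervalIntegral.integral_comp_sub_left (a := 0) (b := π / 2)
      (fun ψ => sin (2 * ψ) ^ m * f ψ) (π / 2)
    rw [sub_self, sub_zero] at this
    rw [← this]
    refine intervalIntegral.integral_congr fun ψ _ => ?_
    rw [show 2 * (π / 2 - ψ) = π - 2 * ψ by ring, sin_pi_sub]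
  have hsum : 2 * ((∫ ψ in (0 : ℝ)..π / 2, sin (2 * ψ) ^ m * f ψ) -
        f (π / 4) * ((∫ x in (0 : ℝ)..π, sin x ^ m) / 2)) =
      ∫ ψ in (0 : ℝ)..π / 2, sin (2 * ψ) ^ m * (f ψ + f (π / 2 - ψ) - 2 * f (π / 4)) := by
    have h : ∀ ψ, sin (2 * ψ) ^ m * (f ψ + f (π / 2 - ψ) - 2 * f (π / 4)) =
        sin (2 * ψ) ^ m * f ψ + sin (2 * ψ) ^ m * f (π / 2 - ψ) -
          2 * f (π / 4) * sin (2 * ψ) ^ m := fun ψ => by ring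
    simp only [h]
    rw [intervalIntegral.integral_sub (Continuous.intervalIntegrable (by fun_prop) _ _)
      (Continuous.intervalIntegrable (by fun_prop) _ _),
      intervalIntegral.integral_add (Continuous.intervalIntegrable (by fun_prop) _ _)
      (Continuous.intervalIntegrable (by fun_prop) _ _), hrefl,
      intervalIntegral.integral_const_mul, integral_sin_two_mul_pow]
    ring
  have hle : |∫ ψ in (0 : ℝ)..π / 2, sin (2 * ψ) ^ m * (f ψ + f (π / 2 - ψ) - 2 * f (π / 4))| ≤
      ∫ ψ in (0 : ℝ)..π / 2, K * (π ^ 2 / 16) * (sin (2 * ψ) ^ m * cos (2 * ψ) ^ 2) := by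
    rw [← Real.norm_eq_abs]
    refine intervalIntegral.norm_integral_le_of_norm_le (by positivity)
      (Filter.Eventually.of_forall fun ψ hψ => ?_)
      (Continuous.intervalIntegrable (by fun_prop) _ _)
    have hs : 0 ≤ sin (2 * ψ) :=
      sin_nonneg_of_nonneg_of_le_pi (by linarith [hψ.1]) (by linarith [hψ.2])
    have ht : |ψ - π / 4| ≤ π / 4 := abs_le.mpr ⟨by linarith [hψ.1], by linarith [hψ.2]⟩
    have h1 := hK (ψ - π / 4) ht
    rw [show π / 4 + (ψ - π / 4) = ψ by ring, show π / 4 - (ψ - π / 4) = π / 2 - ψ by ring] at h1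
    have h2 : (ψ - π / 4) ^ 2 ≤ π ^ 2 / 16 * cos (2 * ψ) ^ 2 := by
      have h3 := Real.mul_abs_le_abs_sin (x := 2 * (ψ - π / 4)) (by
        rw [abs_mul, abs_two]; linarith)
      have h4 : |sin (2 * (ψ - π / 4))| = |cos (2 * ψ)| := by
        rw [show 2 * (ψ - π / 4) = 2 * ψ - π / 2 by ring, sin_sub_pi_div_two, abs_neg]
      rw [h4, abs_mul, abs_two] at h3
      have h5 : |ψ - π / 4| ≤ π / 4 * |cos (2 * ψ)| := by
        have := mul_le_mul_of_nonneg_left h3 (show (0 : ℝ) ≤ π / 4 by positivity)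
        have hp : π / 4 * (2 / π * (2 * |ψ - π / 4|)) = |ψ - π / 4| := by
          field_simp; ring
        linarith
      rw [← sq_abs, ← sq_abs (cos _)]
      calc _ ≤ (π / 4 * |cos (2 * ψ)|) ^ 2 := pow_le_pow_left₀ (abs_nonneg _) h5 2
        _ = _ := by ring
    rw [norm_mul, Real.norm_eq_abs, Real.norm_eq_abs, abs_of_nonneg (pow_nonneg hs m)]
    calc _ ≤ sin (2 * ψ) ^ m * (K * (π ^ 2 / 16 * cos (2 * ψ) ^ 2)) := by
          gcongr
          exact h1.trans (by gcongr)
      _ = _ := by ring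
  rw [intervalIntegral.integral_const_mul, integral_sin_two_mul_pow_mul_cos_sq, ← hsum, abs_mul,
    abs_two] at hle
  have : (m : ℝ) + 2 ≠ 0 := by positivity
  refine le_of_mul_le_mul_left (hle.trans_eq ?_) two_pos
  field_simp
  ring

theorem succ_mul_integral_sin_pow_mul_integral_sin_pow_succ (m : ℕ) :
    (m + 1) * ((∫ x in (0 : ℝ)..π, sin x ^ m) * ∫ x in (0 : ℝ)..π, sin x ^ (m + 1)) = 2 * π := by
  induction m with
  | zero => simp; ring
  | succ m ih =>
    rw [integral_sin_pow]
    have : (m : ℝ) + 2 ≠ 0 := by positivity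
    simp only [sin_pi, sin_zero, zero_pow (Nat.succ_ne_zero m), zero_mul, sub_self, zero_div,
      zero_add]
    push_cast
    rw [← ih]
    field_simp
    ring

theorem integral_sin_pow_sq_bounds {m : ℕ} (hm : 0 < m) :
    2 * π / (m + 1) ≤ (∫ x in (0 : ℝ)..π, sin x ^ m) ^ 2 ∧
      (∫ x in (0 : ℝ)..π, sin x ^ m) ^ 2 ≤ 2 * π / m := by
  obtain ⟨k, rfl⟩ := Nat.exists_eq_succ_of_ne_zero hm.ne'
  have h1 := succ_mul_integral_sin_pow_mul_integral_sin_pow_succ k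
  have h2 := succ_mul_integral_sin_pow_mul_integral_sin_pow_succ (k + 1)
  have p1 := integral_sin_pow_pos (n := k + 1)
  have l1 := integral_sin_pow_succ_le (n := k)
  have l2 := integral_sin_pow_succ_le (n := k + 1)
  push_cast at h1 h2 ⊢
  constructor
  · rw [div_le_iff₀ (by positivity), ← h2, sq]
    have := mul_le_mul_of_nonneg_left l2 p1.le
    nlinarith
  · rw [le_div_iff₀ (by positivity), ← h1, sq]
    have := mul_le_mul_of_nonneg_left l1 p1.le
    nlinarith

theorem jacobiP_zero_eq_integral {α β : ℝ} (hα : -1 < α) (hβ : -1 < β) (m : ℕ) :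
    jacobiP α β (m + 3) 0 = (4 * π)⁻¹ * ∫ ψ in (0 : ℝ)..π / 2, sin (2 * ψ) ^ m *
      ((2 * cos ψ) ^ (α + 3) * (2 * sin ψ) ^ (β + 3) *
        cos ((α + β) * ψ - β * (π / 2) - (m + 3 : ℕ) * (π / 2))) := by
  set n := m + 3 with hn
  have hn3 : (n : ℝ) = m + 3 := by rw [hn]; push_cast; ring
  have hm : (0 : ℝ) ≤ m := m.cast_nonneg
  have ha : 0 < (n : ℝ) + α := by linarith
  have hb : 0 < (n : ℝ) + β := by linarith
  have h1 := congrArg Complex.re (sum_choose_mul_choose_eq_integral ha hb n)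
  rw [Complex.ofReal_re, show (2 * π : ℂ)⁻¹ = (((2 * π)⁻¹ : ℝ) : ℂ) by push_cast; rfl,
    Complex.re_ofReal_mul, integral_circle_eq_integral_trig ha hb] at h1
  have h2 : ∫ ψ in (0 : ℝ)..π / 2, (2 * cos ψ) ^ (n + α) * (2 * sin ψ) ^ (n + β) *
        cos ((n + α) * ψ + (n + β) * (ψ - π / 2) - 2 * n * ψ) =
      2 ^ m * ∫ ψ in (0 : ℝ)..π / 2, sin (2 * ψ) ^ m *
      ((2 * cos ψ) ^ (α + 3) * (2 * sin ψ) ^ (β + 3) *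
        cos ((α + β) * ψ - β * (π / 2) - n * (π / 2))) := by
    rw [← intervalIntegral.integral_const_mul]
    refine intervalIntegral.integral_congr fun ψ hψ => ?_
    rw [Set.uIcc_of_le (by positivity)] at hψ
    have hc : 0 ≤ 2 * cos ψ :=
      mul_nonneg two_pos.le (cos_nonneg_of_mem_Icc ⟨by linarith [hψ.1, pi_pos], hψ.2⟩)
    have hs : 0 ≤ 2 * sin ψ :=
      mul_nonneg two_pos.le (sin_nonneg_of_nonneg_of_le_pi hψ.1 (by linarith [hψ.2, pi_pos]))
    rw [show (n : ℝ) + α = m + (α + 3) by rw [hn3]; ring,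
      show (n : ℝ) + β = m + (β + 3) by rw [hn3]; ring,
      Real.rpow_add_of_nonneg hc hm (by linarith), Real.rpow_add_of_nonneg hs hm (by linarith),
      Real.rpow_natCast, Real.rpow_natCast, sin_two_mul, hn3]
    ring_nf
  rw [jacobiP_zero, h1, h2, show (2 : ℝ) ^ n = 2 ^ m * 8 by rw [hn, pow_add]; norm_num]
  generalize (∫ ψ in (0 : ℝ)..π / 2, sin (2 * ψ) ^ m *
      ((2 * cos ψ) ^ (α + 3) * (2 * sin ψ) ^ (β + 3) *
        cos ((α + β) * ψ - β * (π / 2) - n * (π / 2)))) = J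
  field_simp
  norm_num

theorem contDiff_two_mul_rpow_mul {α β : ℝ} (hα : -1 < α) (hβ : -1 < β) {g : ℝ → ℝ}
    (hg : ContDiff ℝ 2 g) :
    ContDiff ℝ 2 fun ψ => (2 * cos ψ) ^ (α + 3) * (2 * sin ψ) ^ (β + 3) * g ψ := by
  have h1 : ContDiff ℝ 2 fun x : ℝ => x ^ (α + 3) :=
    Real.contDiff_rpow_const_of_le (n := 2) (by push_cast; linarith)
  have h2 : ContDiff ℝ 2 fun x : ℝ => x ^ (β + 3) :=
    Real.contDiff_rpow_const_of_le (n := 2) (by push_cast; linarith)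
  have h3 : ContDiff ℝ 2 fun ψ : ℝ => 2 * cos ψ := contDiff_const.mul contDiff_cos
  have h4 : ContDiff ℝ 2 fun ψ : ℝ => 2 * sin ψ := contDiff_const.mul contDiff_sin
  exact ((h1.comp h3).mul (h2.comp h4)).mul hg

theorem exists_abs_jacobiP_zero_sub_le {α β : ℝ} (hα : -1 < α) (hβ : -1 < β) :
    ∃ K, 0 ≤ K ∧ ∀ m : ℕ,
      |jacobiP α β (m + 3) 0 - π⁻¹ * 2 ^ ((α + β) / 2) *
          cos ((m + 3 : ℕ) * (π / 2) + (β - α) * (π / 4)) * ∫ x in (0 : ℝ)..π, sin x ^ m| ≤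
        K / (m + 2) * ∫ x in (0 : ℝ)..π, sin x ^ m := by
  set w : ℝ → ℝ := fun ψ => (2 * cos ψ) ^ (α + 3) * (2 * sin ψ) ^ (β + 3) with hw
  set u : ℝ → ℝ := fun ψ => w ψ * cos ((α + β) * ψ - β * (π / 2)) with hu
  set v : ℝ → ℝ := fun ψ => w ψ * sin ((α + β) * ψ - β * (π / 2)) with hv
  have hcu : ContDiff ℝ 2 u := contDiff_two_mul_rpow_mul hα hβ (by fun_prop)
  have hcv : ContDiff ℝ 2 v := contDiff_two_mul_rpow_mul hα hβ (by fun_prop)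
  obtain ⟨K₁, hK₁, h₁⟩ := exists_abs_integral_sin_two_mul_pow_mul_sub_le hcu
  obtain ⟨K₂, hK₂, h₂⟩ := exists_abs_integral_sin_two_mul_pow_mul_sub_le hcv
  have hw4 : w (π / 4) = 8 * 2 ^ ((α + β) / 2) := by
    simp only [hw]
    rw [cos_pi_div_four, sin_pi_div_four, mul_div_cancel₀ _ two_ne_zero,
      ← Real.rpow_add (by positivity), Real.sqrt_eq_rpow, ← Real.rpow_mul two_pos.le,
      show (8 : ℝ) = 2 ^ (3 : ℝ) by norm_num, ← Real.rpow_add two_pos]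
    congr 1; ring
  refine ⟨(4 * π)⁻¹ * (K₁ + K₂), by positivity, fun m => ?_⟩
  specialize h₁ m
  specialize h₂ m
  have hW := integral_sin_pow_pos (n := m)
  set W := ∫ x in (0 : ℝ)..π, sin x ^ m
  set ν : ℝ := (m + 3 : ℕ) * (π / 2) with hν
  have hsplit : jacobiP α β (m + 3) 0 = (4 * π)⁻¹ *
      (cos ν * (∫ ψ in (0 : ℝ)..π / 2, sin (2 * ψ) ^ m * u ψ) +
        sin ν * ∫ ψ in (0 : ℝ)..π / 2, sin (2 * ψ) ^ m * v ψ) := by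
    have hcu' := hcu.continuous
    have hcv' := hcv.continuous
    rw [jacobiP_zero_eq_integral hα hβ]
    congr 1
    have hX : Continuous fun ψ => cos ν * (sin (2 * ψ) ^ m * u ψ) := by fun_prop
    have hY : Continuous fun ψ => sin ν * (sin (2 * ψ) ^ m * v ψ) := by fun_prop
    rw [← intervalIntegral.integral_const_mul, ← intervalIntegral.integral_const_mul,
      ← intervalIntegral.integral_add (hX.intervalIntegrable _ _) (hY.intervalIntegrable _ _)]
    refine intervalIntegral.integral_congr fun ψ _ => ?_
    simp only [hu, hv, hw, ← hν]
    rw [cos_sub (_ - _)]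
    ring
  have hval : π⁻¹ * 2 ^ ((α + β) / 2) * cos (ν + (β - α) * (π / 4)) * W =
      (4 * π)⁻¹ * (cos ν * (u (π / 4) * (W / 2)) + sin ν * (v (π / 4) * (W / 2))) := by
    simp only [hu, hv, hw4]
    rw [show ν + (β - α) * (π / 4) = ν - ((α + β) * (π / 4) - β * (π / 2)) by ring, cos_sub ν]
    field_simp
    ring
  rw [hsplit, hval, ← mul_sub, abs_mul, abs_of_pos (show 0 < (4 * π)⁻¹ by positivity),
    show (4 * π)⁻¹ * (K₁ + K₂) / (m + 2) * W =
      (4 * π)⁻¹ * (K₁ / (m + 2) * W + K₂ / (m + 2) * W) by ring]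
  refine mul_le_mul_of_nonneg_left ?_ (by positivity)
  set X := ∫ ψ in (0 : ℝ)..π / 2, sin (2 * ψ) ^ m * u ψ
  set Y := ∫ ψ in (0 : ℝ)..π / 2, sin (2 * ψ) ^ m * v ψ
  calc |cos ν * X + sin ν * Y - (cos ν * (u (π / 4) * (W / 2)) + sin ν * (v (π / 4) * (W / 2)))|
      = |cos ν * (X - u (π / 4) * (W / 2)) + sin ν * (Y - v (π / 4) * (W / 2))| := by
        congr 1; ring
    _ ≤ |cos ν * (X - u (π / 4) * (W / 2))| + |sin ν * (Y - v (π / 4) * (W / 2))| := abs_add_le _ _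
    _ ≤ 1 * (K₁ / (m + 2) * W) + 1 * (K₂ / (m + 2) * W) := by
        rw [abs_mul, abs_mul]
        gcongr
        · exact abs_cos_le_one ν
        · exact abs_sin_le_one ν
    _ = _ := by ring

/-- First-order asymptotics of the Jacobi polynomials at the point `0`. -/
theorem exists_abs_sqrt_mul_jacobiP_zero_sub_cos_le {α β : ℝ} (hα : -1 < α) (hβ : -1 < β) :
    ∃ C, 0 ≤ C ∧ ∃ N : ℕ, ∀ n : ℕ, N ≤ n →
      |√(π * (n + (α + β + 1) / 2)) * 2 ^ (-((α + β + 1) / 2)) * jacobiP α β n 0 -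
          cos (n * (π / 2) + (β - α) * (π / 4))| ≤ C / (n + (α + β + 1) / 2) := by
  obtain ⟨K, hK0, hK⟩ := exists_abs_jacobiP_zero_sub_le hα hβ
  set s := (α + β + 1) / 2 with hs
  have hs1 : -1 / 2 < s := by rw [hs]; linarith
  set D := 3 + |s| with hD
  have hD3 : 3 ≤ D := by rw [hD]; linarith [abs_nonneg s]
  set A := √π * 2 ^ (-s) * K with hA
  have hA0 : 0 ≤ A := by positivity
  refine ⟨(A * (√(2 * π) * (1 + D)) + D) * (1 + D), by positivity, 4, fun n hn => ?_⟩
  obtain ⟨m, rfl⟩ : ∃ m, n = m + 3 := ⟨n - 3, by omega⟩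
  have hm1 : 0 < m := by omega
  have hm1' : (1 : ℝ) ≤ m := by exact_mod_cast hm1
  specialize hK m
  obtain ⟨hlo, hhi⟩ := integral_sin_pow_sq_bounds hm1
  have hW := integral_sin_pow_pos (n := m)
  set W := ∫ x in (0 : ℝ)..π, sin x ^ m
  set ν : ℝ := (m + 3 : ℕ) * (π / 2) + (β - α) * (π / 4)
  set κ : ℝ := (m + 3 : ℕ) + s with hκ
  have hκm : κ = m + 3 + s := by rw [hκ]; push_cast; ring
  have hκ0 : 0 < κ := by rw [hκm]; linarith
  have hκD : κ ≤ m + D := by rw [hκm, hD]; linarith [le_abs_self s]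
  have hκD' : κ ≤ m * (1 + D) := by nlinarith
  set ρ := √κ * W / √(2 * π) with hρ
  have hρ0 : 0 ≤ ρ := by positivity
  have hρsq : ρ ^ 2 = κ * (W ^ 2 / (2 * π)) := by
    rw [hρ, div_pow, mul_pow, Real.sq_sqrt hκ0.le, Real.sq_sqrt (by positivity)]; ring
  have hlo' : κ / (m + 1) ≤ ρ ^ 2 := by
    rw [hρsq, div_eq_mul_one_div]
    refine mul_le_mul_of_nonneg_left ?_ hκ0.le
    rw [le_div_iff₀ (by positivity)]
    calc _ = 2 * π / (m + 1) := by ring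
      _ ≤ _ := hlo
  have hhi' : ρ ^ 2 ≤ κ / m := by
    rw [hρsq, div_eq_mul_one_div κ]
    refine mul_le_mul_of_nonneg_left ?_ hκ0.le
    rw [div_le_iff₀ (by positivity)]
    calc _ ≤ 2 * π / m := hhi
      _ = _ := by ring
  have hρ1 : 1 ≤ ρ := by
    have : 1 ≤ κ / (m + 1) := by rw [le_div_iff₀ (by positivity), hκm]; linarith
    nlinarith
  have hinv : (1 : ℝ) / m ≤ (1 + D) / κ := by
    rw [div_le_div_iff₀ (by positivity) hκ0]; linarith
  have hρD : ρ - 1 ≤ D / m := by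
    have : κ / m ≤ 1 + D / m := by
      rw [div_le_iff₀ (by positivity), add_mul, div_mul_cancel₀ _ (by positivity)]; linarith
    nlinarith
  have hρbd : ρ ≤ 1 + D := by
    have : D / m ≤ D := div_le_self (by linarith) hm1'
    linarith
  have hrew : √(π * κ) * 2 ^ (-s) * (π⁻¹ * 2 ^ ((α + β) / 2) * cos ν * W) = ρ * cos ν := by
    have h2 : (2 : ℝ) ^ (-s) * 2 ^ ((α + β) / 2) = (√2)⁻¹ := by
      rw [← Real.rpow_add two_pos, Real.sqrt_eq_rpow, ← Real.rpow_neg two_pos.le]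
      congr 1; rw [hs]; ring
    have h3 : √π * π⁻¹ = (√π)⁻¹ := by
      rw [← div_eq_mul_inv, Real.sqrt_div_self]
    calc √(π * κ) * 2 ^ (-s) * (π⁻¹ * 2 ^ ((α + β) / 2) * cos ν * W)
        = √κ * W * cos ν * (2 ^ (-s) * 2 ^ ((α + β) / 2)) * (√π * π⁻¹) := by
          rw [Real.sqrt_mul pi_pos.le]; ring
      _ = ρ * cos ν := by
          rw [h2, h3, hρ, Real.sqrt_mul two_pos.le]; field_simp
  have herr : √(π * κ) * 2 ^ (-s) * (K / (m + 2) * W) ≤ A * (√(2 * π) * (1 + D)) * (1 / m) := by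
    have h4 : √κ * W = √(2 * π) * ρ := by
      rw [hρ, mul_div_cancel₀]; positivity
    rw [Real.sqrt_mul pi_pos.le]
    calc √π * √κ * 2 ^ (-s) * (K / (m + 2) * W) = A * (√κ * W) * (1 / (m + 2)) := by rw [hA]; ring
      _ = A * (√(2 * π) * ρ) * (1 / (m + 2)) := by rw [h4]
      _ ≤ _ := by gcongr; linarith
  have hpos : 0 ≤ √(π * κ) * 2 ^ (-s) := by positivity
  calc |√(π * κ) * 2 ^ (-s) * jacobiP α β (m + 3) 0 - cos ν|
      = |√(π * κ) * 2 ^ (-s) * (jacobiP α β (m + 3) 0 - π⁻¹ * 2 ^ ((α + β) / 2) * cos ν * W) +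
          (ρ - 1) * cos ν| := by
        rw [mul_sub, hrew]; congr 1; ring
    _ ≤ √(π * κ) * 2 ^ (-s) * (K / (m + 2) * W) + (ρ - 1) * 1 := by
        refine (abs_add_le _ _).trans (add_le_add ?_ ?_)
        · rw [abs_mul, abs_of_nonneg hpos]
          exact mul_le_mul_of_nonneg_left hK hpos
        · rw [abs_mul, abs_of_nonneg (by linarith : 0 ≤ ρ - 1)]
          exact mul_le_mul_of_nonneg_left (abs_cos_le_one _) (by linarith)
    _ ≤ A * (√(2 * π) * (1 + D)) * (1 / m) + D * (1 / m) := by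
        rw [mul_one, mul_one_div D]; exact add_le_add herr hρD
    _ = (A * (√(2 * π) * (1 + D)) + D) * (1 / m) := by ring
    _ ≤ (A * (√(2 * π) * (1 + D)) + D) * ((1 + D) / κ) := by gcongr
    _ = _ := by ring

theorem hasDerivAt_sum_mul_half_sub_pow (c : ℕ → ℝ) (e : ℕ → ℕ) (s : Finset ℕ) (x : ℝ) :
    HasDerivAt (fun x : ℝ => ∑ ℓ ∈ s, c ℓ * ((x - 1) / 2) ^ e ℓ)
      (∑ ℓ ∈ s, c ℓ * e ℓ / 2 * ((x - 1) / 2) ^ (e ℓ - 1)) x := by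
  refine HasDerivAt.fun_sum fun ℓ _ => ?_
  have h := ((((hasDerivAt_id x).sub_const 1).div_const 2).pow (e ℓ)).const_mul (c ℓ)
  refine h.congr_deriv ?_
  simp only [id]
  ring

theorem hasDerivAt_jacobiP_succ (α β : ℝ) (n : ℕ) (x : ℝ) :
    HasDerivAt (jacobiP α β (n + 1))
      ((n + α + β + 2) / 2 * jacobiP (α + 1) (β + 1) n x) x := by
  refine (hasDerivAt_sum_mul_half_sub_pow _ id _ x).congr_deriv ?_
  rw [Finset.sum_range_succ', jacobiP, Finset.mul_sum]
  simp only [id, Nat.cast_zero, mul_zero, zero_div, zero_mul, add_zero]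
  refine Finset.sum_congr rfl fun ℓ _ => ?_
  rw [Nat.add_sub_cancel, Nat.add_sub_add_right, Nat.factorial_succ, ascPochhammer_succ_left]
  simp only [Polynomial.eval_mul, Polynomial.eval_comp, Polynomial.eval_add, Polynomial.eval_X,
    Polynomial.eval_one]
  push_cast
  rw [show (n : ℝ) + 1 + α + β + 1 + 1 = n + (α + 1) + (β + 1) + 1 by ring,
    show α + ((ℓ : ℝ) + 1) + 1 = α + 1 + ℓ + 1 by ring]
  have : (ℓ : ℝ) + 1 ≠ 0 := by positivity
  field_simp
  ring

/-- The Jacobi differential equation. -/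
theorem exists_hasDerivAt_jacobiP_ode (α β : ℝ) (n : ℕ) :
    ∃ p₁ p₂ : ℝ → ℝ, (∀ x, HasDerivAt (jacobiP α β n) (p₁ x) x) ∧
      (∀ x, HasDerivAt p₁ (p₂ x) x) ∧
      ∀ x, (1 - x ^ 2) * p₂ x + (β - α - (α + β + 2) * x) * p₁ x +
        n * (n + α + β + 1) * jacobiP α β n x = 0 := by
  set c : ℕ → ℝ := fun ℓ => ((ascPochhammer ℝ ℓ).eval ((n : ℝ) + α + β + 1) *
    (ascPochhammer ℝ (n - ℓ)).eval (α + (ℓ : ℝ) + 1)) /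
      ((Nat.factorial ℓ : ℝ) * (Nat.factorial (n - ℓ) : ℝ)) with hc
  have hrec : ∀ ℓ < n, (ℓ + 1) * (ℓ + 1 + α) * c (ℓ + 1) =
      (n - ℓ) * (n + ℓ + α + β + 1) * c ℓ := by
    intro ℓ hℓ
    obtain ⟨k, rfl⟩ : ∃ k, n = ℓ + 1 + k := ⟨n - (ℓ + 1), by omega⟩
    simp only [hc]
    rw [show ℓ + 1 + k - ℓ = k + 1 by omega, Nat.add_sub_cancel_left, Nat.factorial_succ,
      Nat.factorial_succ, ascPochhammer_succ_eval, ascPochhammer_succ_left ℝ k]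
    simp only [Polynomial.eval_mul, Polynomial.eval_comp, Polynomial.eval_add, Polynomial.eval_X,
      Polynomial.eval_one]
    push_cast
    rw [show α + ((ℓ : ℝ) + 1) + 1 = α + ℓ + 1 + 1 by ring]
    have : (ℓ : ℝ) + 1 ≠ 0 := by positivity
    have : (k : ℝ) + 1 ≠ 0 := by positivity
    field_simp
    ring
  refine ⟨_, _, hasDerivAt_sum_mul_half_sub_pow c id _,
    hasDerivAt_sum_mul_half_sub_pow (fun ℓ => c ℓ * id ℓ / 2) (fun ℓ => ℓ - 1) _, fun x => ?_⟩
  set y := (x - 1) / 2 with hy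
  have hx : x = 1 + 2 * y := by rw [hy]; ring
  have hP : jacobiP α β n x = ∑ ℓ ∈ Finset.range (n + 1), c ℓ * y ^ ℓ := rfl
  set g : ℕ → ℝ := fun ℓ => c ℓ * ℓ * (ℓ + α) * y ^ (ℓ - 1) with hg
  have hterm : ∀ ℓ, (1 - x ^ 2) * (c ℓ * id ℓ / 2 * (ℓ - 1 : ℕ) / 2 * y ^ (ℓ - 1 - 1)) +
      (β - α - (α + β + 2) * x) * (c ℓ * id ℓ / 2 * y ^ (id ℓ - 1)) +
      n * (n + α + β + 1) * (c ℓ * y ^ ℓ) =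
        (n - ℓ) * (n + ℓ + α + β + 1) * c ℓ * y ^ ℓ - g ℓ := by
    intro ℓ
    simp only [hg, id, hx]
    rcases ℓ with _ | _ | ℓ
    · simp
    · simp; ring
    · simp only [Nat.add_sub_cancel]
      push_cast
      ring
  rw [hP, Finset.mul_sum, Finset.mul_sum, Finset.mul_sum, ← Finset.sum_add_distrib,
    ← Finset.sum_add_distrib, Finset.sum_congr rfl fun ℓ _ => hterm ℓ, Finset.sum_sub_distrib,
    Finset.sum_range_succ, Finset.sum_range_succ' g]
  have : ∀ ℓ ∈ Finset.range n, (n - ℓ) * (n + ℓ + α + β + 1) * c ℓ * y ^ ℓ = g (ℓ + 1) := by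
    intro ℓ hℓ
    rw [← hrec ℓ (Finset.mem_range.mp hℓ)]
    simp only [hg, Nat.add_sub_cancel]
    push_cast
    ring
  rw [Finset.sum_congr rfl this]
  simp [hg]

/-- The Jacobi differential equation in its trigonometric (Liouville) normal form, with the initial
data at `π / 2`. -/
theorem exists_hasDerivAt_normal_form (α β : ℝ) (n : ℕ) {u : ℝ → ℝ}
    (hu : ∀ θ, u θ = sin (θ / 2) ^ (α + 1 / 2) * cos (θ / 2) ^ (β + 1 / 2) *
      jacobiP α β n (cos θ)) :
    ∃ v : ℝ → ℝ, (∀ θ ∈ Set.Ioo 0 π, HasDerivAt u (v θ) θ) ∧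
      (∀ θ ∈ Set.Ioo 0 π, HasDerivAt v (-((n + (α + β + 1) / 2) ^ 2 +
        ((1 / 4 - α ^ 2) / (4 * sin (θ / 2) ^ 2) + (1 / 4 - β ^ 2) / (4 * cos (θ / 2) ^ 2))) *
          u θ) θ) ∧
      u (π / 2) = 2 ^ (-((α + β + 1) / 2)) * jacobiP α β n 0 ∧
      v (π / 2) = 2 ^ (-((α + β + 1) / 2)) *
        ((α - β) / 2 * jacobiP α β n 0 - deriv (jacobiP α β n) 0) := by
  obtain ⟨p₁, p₂, hp₁, hp₂, hode⟩ := exists_hasDerivAt_jacobiP_ode α β n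
  set a := α + 1 / 2 with ha
  set b := β + 1 / 2 with hb
  set w : ℝ → ℝ := fun θ => sin (θ / 2) ^ a * cos (θ / 2) ^ b with hw
  set L : ℝ → ℝ := fun θ => (a * (cos (θ / 2) / sin (θ / 2)) -
    b * (sin (θ / 2) / cos (θ / 2))) / 2 with hL
  obtain rfl : u = fun θ => w θ * jacobiP α β n (cos θ) := funext hu
  have hs : ∀ θ : ℝ, HasDerivAt (fun θ => sin (θ / 2)) (cos (θ / 2) / 2) θ := fun θ => by
    simpa [div_eq_mul_inv] using ((hasDerivAt_id θ).div_const 2).sin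
  have hc : ∀ θ : ℝ, HasDerivAt (fun θ => cos (θ / 2)) (-sin (θ / 2) / 2) θ := fun θ => by
    simpa [div_eq_mul_inv] using ((hasDerivAt_id θ).div_const 2).cos
  have hs0 : ∀ θ ∈ Set.Ioo 0 π, 0 < sin (θ / 2) := fun θ hθ =>
    sin_pos_of_pos_of_lt_pi (by linarith [hθ.1]) (by linarith [hθ.1, hθ.2])
  have hc0 : ∀ θ ∈ Set.Ioo 0 π, 0 < cos (θ / 2) := fun θ hθ =>
    cos_pos_of_mem_Ioo ⟨by linarith [hθ.1, pi_pos], by linarith [hθ.2]⟩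
  have hwd : ∀ θ ∈ Set.Ioo 0 π, HasDerivAt w (w θ * L θ) θ := fun θ hθ => by
    have h1 := hs0 θ hθ
    have h2 := hc0 θ hθ
    refine (((hs θ).rpow_const (p := a) (Or.inl h1.ne')).mul
      ((hc θ).rpow_const (p := b) (Or.inl h2.ne'))).congr_deriv ?_
    simp only [hw, hL]
    rw [Real.rpow_sub_one h1.ne', Real.rpow_sub_one h2.ne']
    field_simp
    ring
  have hLd : ∀ θ ∈ Set.Ioo 0 π, HasDerivAt L
      (-(a / sin (θ / 2) ^ 2 + b / cos (θ / 2) ^ 2) / 4) θ := fun θ hθ => by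
    have h1 := (hs0 θ hθ).ne'
    have h2 := (hc0 θ hθ).ne'
    refine (((((hc θ).div (hs θ) h1).const_mul a).sub
      (((hs θ).div (hc θ) h2).const_mul b)).div_const 2).congr_deriv ?_
    have h3 := sin_sq_add_cos_sq (θ / 2)
    field_simp
    linear_combination (-4 * a * cos (θ / 2) ^ 2 - 4 * b * sin (θ / 2) ^ 2) * h3
  have hP : ∀ θ : ℝ, HasDerivAt (fun θ => jacobiP α β n (cos θ)) (p₁ (cos θ) * -sin θ) θ :=
    fun θ => (hp₁ (cos θ)).comp θ (hasDerivAt_cos θ)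
  have hP₁ : ∀ θ : ℝ, HasDerivAt (fun θ => p₁ (cos θ)) (p₂ (cos θ) * -sin θ) θ :=
    fun θ => (hp₂ (cos θ)).comp θ (hasDerivAt_cos θ)
  have hw2 : w (π / 2) = 2 ^ (-((α + β + 1) / 2)) := by
    simp only [hw]
    rw [show π / 2 / 2 = π / 4 by ring, cos_pi_div_four, sin_pi_div_four,
      ← Real.rpow_add (by positivity), Real.sqrt_div_self', Real.sqrt_eq_rpow, one_div,
      ← Real.rpow_neg two_pos.le, ← Real.rpow_mul two_pos.le]
    congr 1
    rw [ha, hb]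
    ring
  refine ⟨fun θ => w θ * (L θ * jacobiP α β n (cos θ) - sin θ * p₁ (cos θ)), fun θ hθ => ?_,
    fun θ hθ => ?_, ?_, ?_⟩
  · refine ((hwd θ hθ).mul (hP θ)).congr_deriv ?_
    ring
  · have h1 := (hs0 θ hθ).ne'
    have h2 := (hc0 θ hθ).ne'
    refine ((hwd θ hθ).mul (((hLd θ hθ).mul (hP θ)).sub
      ((hasDerivAt_sin θ).mul (hP₁ θ)))).congr_deriv ?_
    have hcos : cos θ = cos (θ / 2) ^ 2 - sin (θ / 2) ^ 2 := by
      rw [← cos_two_mul' (θ / 2)]; ring_nf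
    have hsin : sin θ = 2 * sin (θ / 2) * cos (θ / 2) := by
      rw [← sin_two_mul (θ / 2)]; ring_nf
    have hL1 : 2 * L θ * sin θ + cos θ = α - β + (α + β + 2) * cos θ := by
      simp only [hL]
      rw [hsin, hcos, ha, hb]
      field_simp
      linear_combination (α - β) * sin_sq_add_cos_sq (θ / 2)
    have hL2 : L θ ^ 2 + -(a / sin (θ / 2) ^ 2 + b / cos (θ / 2) ^ 2) / 4 -
        n * (n + α + β + 1) = -((n + (α + β + 1) / 2) ^ 2 +
        ((1 / 4 - α ^ 2) / (4 * sin (θ / 2) ^ 2) + (1 / 4 - β ^ 2) / (4 * cos (θ / 2) ^ 2))) := by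
      have h4 : L θ ^ 2 =
          (a ^ 2 / sin (θ / 2) ^ 2 + b ^ 2 / cos (θ / 2) ^ 2 - (a + b) ^ 2) / 4 := by
        simp only [hL]
        have h5 := sin_sq_add_cos_sq (θ / 2)
        field_simp
        linear_combination 4 * (a ^ 2 * cos (θ / 2) ^ 2 + b ^ 2 * sin (θ / 2) ^ 2) * h5
      rw [h4, ha, hb]
      field_simp
      ring
    have hode' := hode (cos θ)
    rw [show 1 - cos θ ^ 2 = sin θ ^ 2 by linarith [sin_sq_add_cos_sq θ]] at hode'
    rw [← hL2]
    simp only [Pi.mul_apply, Pi.sub_apply]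
    linear_combination w θ * hode' - w θ * p₁ (cos θ) * hL1
  · simp only [cos_pi_div_two, hw2]
  · simp only [cos_pi_div_two, sin_pi_div_two, hw2, (hp₁ 0).deriv]
    simp only [hL]
    rw [show π / 2 / 2 = π / 4 by ring, cos_pi_div_four, sin_pi_div_four, div_self (by positivity),
      ha, hb]
    ring

/-- For bounded `q`, a function whose second derivative is `-(κ ^ 2 + q) * u` stays close to the
harmonic oscillation with the same initial data. -/
theorem abs_sub_oscillation_le {u v q : ℝ → ℝ} {a b c κ Q : ℝ} (hκ : 0 < κ) (hQ : 4 * Q ≤ κ)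
    (hc : c ∈ Set.Icc a b) (hab : ∀ θ ∈ Set.Icc a b, |θ - c| ≤ 2)
    (hu : ∀ θ ∈ Set.Icc a b, HasDerivAt u (v θ) θ)
    (hv : ∀ θ ∈ Set.Icc a b, HasDerivAt v (-(κ ^ 2 + q θ) * u θ) θ)
    (hq : ∀ θ ∈ Set.Icc a b, |q θ| ≤ Q) {θ : ℝ} (hθ : θ ∈ Set.Icc a b) :
    |κ * u θ - (v c * sin (κ * (θ - c)) + κ * u c * cos (κ * (θ - c)))| ≤
      4 * Q / κ * (|v c| + κ * |u c|) := by
  have hQ0 : 0 ≤ Q := (abs_nonneg _).trans (hq c hc)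
  set z : ℝ → ℂ := fun θ => (v θ + Complex.I * κ * u θ) *
    Complex.exp (-(Complex.I * κ * (θ - c))) with hz
  have hnexp : ∀ t : ℝ, ‖Complex.exp (-(Complex.I * κ * (t - c)))‖ = 1 := fun t => by
    rw [Complex.norm_exp]
    simp
  have hzd : ∀ t ∈ Set.Icc a b, HasDerivAt z
      (-(q t * u t) * Complex.exp (-(Complex.I * κ * (t - c)))) t := by
    intro t ht
    have h1 := (hv t ht).ofReal_comp.add ((hu t ht).ofReal_comp.const_mul (Complex.I * κ))
    have h2 := ((((hasDerivAt_id t).ofReal_comp.sub_const (c : ℂ)).const_mul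
      (Complex.I * κ)).neg).cexp
    refine (h1.mul h2).congr_deriv ?_
    simp only [id, Pi.add_apply, Pi.neg_apply]
    push_cast
    linear_combination (κ ^ 2 * u t * Complex.exp (-(Complex.I * κ * (t - c)))) *
      (-Complex.I_sq)
  have hκu : ∀ t, κ * |u t| ≤ ‖z t‖ := fun t => by
    simp only [hz]
    rw [norm_mul, hnexp, mul_one]
    calc κ * |u t| = |(v t + Complex.I * κ * u t : ℂ).im| := by
          simp [abs_mul, abs_of_pos hκ]
      _ ≤ _ := Complex.abs_im_le_norm _
  obtain ⟨t₀, ht₀, hmax⟩ := isCompact_Icc.exists_isMaxOn ⟨c, hc⟩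
    (fun t ht => (hzd t ht).continuousAt.continuousWithinAt.norm :
      ContinuousOn (fun t => ‖z t‖) (Set.Icc a b))
  set M := ‖z t₀‖
  have hM : ∀ t ∈ Set.Icc a b, ‖z t‖ ≤ M := fun t ht => hmax ht
  have hM0 : 0 ≤ M := norm_nonneg _
  have hlip : ∀ t ∈ Set.Icc a b, ‖z t - z c‖ ≤ 2 * Q / κ * M := by
    intro t ht
    have := (convex_Icc a b).norm_image_sub_le_of_norm_hasDerivWithin_le (C := Q / κ * M)
      (fun x hx => (hzd x hx).hasDerivWithinAt) (fun x hx => by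
        rw [norm_mul, hnexp, mul_one, norm_neg, norm_mul, Complex.norm_real, Complex.norm_real,
          Real.norm_eq_abs, Real.norm_eq_abs, div_mul_eq_mul_div, mul_div_assoc]
        refine mul_le_mul (hq x hx) ?_ (abs_nonneg _) hQ0
        rw [le_div_iff₀ hκ, mul_comm]
        exact (hκu x).trans (hM x hx)) hc ht
    refine this.trans ?_
    rw [Real.norm_eq_abs]
    calc Q / κ * M * |t - c| ≤ Q / κ * M * 2 := by gcongr; exact hab t ht
      _ = _ := by ring
  have hM2 : M ≤ 2 * ‖z c‖ := by
    have h1 : 2 * Q / κ * M ≤ 1 / 2 * M := by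
      refine mul_le_mul_of_nonneg_right ?_ hM0
      rw [div_le_iff₀ hκ]
      linarith
    have h2 : M ≤ ‖z t₀ - z c‖ + ‖z c‖ := by
      simpa using norm_add_le (z t₀ - z c) (z c)
    linarith [hlip t₀ ht₀]
  have hzc : z c = v c + Complex.I * κ * u c := by simp [hz]
  have hzc' : ‖z c‖ ≤ |v c| + κ * |u c| := by
    rw [hzc]
    refine (norm_add_le _ _).trans_eq ?_
    simp [abs_of_pos hκ]
  have him : κ * u θ - (v c * sin (κ * (θ - c)) + κ * u c * cos (κ * (θ - c))) =
      ((z θ - z c) * Complex.exp (Complex.I * κ * (θ - c))).im := by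
    have h1 : z θ * Complex.exp (Complex.I * κ * (θ - c)) = v θ + Complex.I * κ * u θ := by
      simp only [hz]
      rw [mul_assoc, ← Complex.exp_add, neg_add_cancel, Complex.exp_zero, mul_one]
    have h2 : Complex.exp (Complex.I * κ * (θ - c)) =
        cos (κ * (θ - c)) + sin (κ * (θ - c)) * Complex.I := by
      push_cast
      rw [← Complex.exp_mul_I]
      ring_nf
    rw [sub_mul, h1, hzc, h2]
    generalize cos (κ * (θ - c)) = x, sin (κ * (θ - c)) = y
    simp
  have hnexp' : ‖Complex.exp (Complex.I * κ * (θ - c))‖ = 1 := by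
    rw [Complex.norm_exp]
    simp
  calc _ ≤ ‖z θ - z c‖ * 1 := by
        rw [him, ← hnexp', ← norm_mul]
        exact Complex.abs_im_le_norm _
    _ ≤ 2 * Q / κ * (2 * ‖z c‖) := by
        rw [mul_one]
        exact (hlip θ hθ).trans (by gcongr)
    _ = 4 * Q / κ * ‖z c‖ := by ring
    _ ≤ _ := by gcongr

theorem exists_abs_sqrt_mul_deriv_jacobiP_zero_add_sin_le {α β : ℝ} (hα : -1 < α) (hβ : -1 < β) :
    ∃ C, 0 ≤ C ∧ ∃ N : ℕ, ∀ n : ℕ, N ≤ n →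
      |√(π * (n + (α + β + 1) / 2)) * (2 ^ (-((α + β + 1) / 2)) *
          ((α - β) / 2 * jacobiP α β n 0 - deriv (jacobiP α β n) 0)) / (n + (α + β + 1) / 2) +
          sin (n * (π / 2) + (β - α) * (π / 4))| ≤ C / (n + (α + β + 1) / 2) := by
  obtain ⟨C₁, hC₁, N₁, h₁⟩ := exists_abs_sqrt_mul_jacobiP_zero_sub_cos_le hα hβ
  obtain ⟨C₂, hC₂, N₂, h₂⟩ := exists_abs_sqrt_mul_jacobiP_zero_sub_cos_le
    (show -1 < α + 1 by linarith) (show -1 < β + 1 by linarith)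
  refine ⟨|α - β| / 2 * (1 + C₁) + C₂ + |(α + β + 1) / 2| * (1 + C₂), by positivity,
    N₁ + N₂ + 2, fun n hn => ?_⟩
  obtain ⟨m, rfl⟩ : ∃ m, n = m + 1 := ⟨n - 1, by omega⟩
  specialize h₁ (m + 1) (by omega)
  specialize h₂ m (by omega)
  have hm : (1 : ℝ) ≤ m := by exact_mod_cast (show 1 ≤ m by omega)
  rw [(hasDerivAt_jacobiP_succ α β m 0).deriv]
  rw [show (m : ℝ) + (α + 1 + (β + 1) + 1) / 2 = (m + 1 : ℕ) + (α + β + 1) / 2 by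
      push_cast; ring,
    show (m : ℝ) * (π / 2) + (β + 1 - (α + 1)) * (π / 4) =
      (m + 1 : ℕ) * (π / 2) + (β - α) * (π / 4) - π / 2 by push_cast; ring, cos_sub_pi_div_two,
    show -((α + 1 + (β + 1) + 1) / 2) = -((α + β + 1) / 2) - 1 by ring,
    Real.rpow_sub_one two_ne_zero] at h₂
  have hcast : (m : ℝ) + α + β + 2 = ((m + 1 : ℕ) + (α + β + 1) / 2) + (α + β + 1) / 2 := by
    push_cast; ring
  rw [hcast]
  have hκ1 : 1 ≤ ((m + 1 : ℕ) : ℝ) + (α + β + 1) / 2 := by push_cast; linarith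
  set κ := ((m + 1 : ℕ) : ℝ) + (α + β + 1) / 2
  set ν := ((m + 1 : ℕ) : ℝ) * (π / 2) + (β - α) * (π / 4)
  set s := (α + β + 1) / 2
  set X := √(π * κ) * 2 ^ (-s) * jacobiP α β (m + 1) 0 with hX
  set Y := √(π * κ) * (2 ^ (-s) / 2) * jacobiP (α + 1) (β + 1) m 0 with hY
  have hκ0 : 0 < κ := by linarith
  have hXb : |X| ≤ 1 + C₁ := by
    calc |X| = |cos ν + (X - cos ν)| := by congr 1; ring
      _ ≤ |cos ν| + |X - cos ν| := abs_add_le _ _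
      _ ≤ 1 + C₁ := add_le_add (abs_cos_le_one _) (h₁.trans (div_le_self hC₁ hκ1))
  have hYb : |Y| ≤ 1 + C₂ := by
    calc |Y| = |sin ν + (Y - sin ν)| := by congr 1; ring
      _ ≤ |sin ν| + |Y - sin ν| := abs_add_le _ _
      _ ≤ 1 + C₂ := add_le_add (abs_sin_le_one _) (h₂.trans (div_le_self hC₂ hκ1))
  have hsplit : √(π * κ) * (2 ^ (-s) * ((α - β) / 2 * jacobiP α β (m + 1) 0 -
      (κ + s) / 2 * jacobiP (α + 1) (β + 1) m 0)) / κ + sin ν =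
      (α - β) / 2 / κ * X - (Y - sin ν) - s / κ * Y := by
    rw [hX, hY]
    field_simp
    ring
  rw [hsplit]
  calc |(α - β) / 2 / κ * X - (Y - sin ν) - s / κ * Y|
      ≤ |(α - β) / 2 / κ * X| + |Y - sin ν| + |s / κ * Y| :=
        (abs_sub _ _).trans (add_le_add_left (abs_sub _ _) _)
    _ ≤ |α - β| / 2 / κ * (1 + C₁) + C₂ / κ + |s| / κ * (1 + C₂) := by
        rw [abs_mul _ X, abs_mul _ Y, abs_div _ κ, abs_div s, abs_div (α - β),
          abs_of_pos hκ0, abs_two]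
        gcongr
    _ = _ := by ring

theorem jacobi_elementary_first_order (α β : ℝ) (hα : -1 < α) (hβ : -1 < β)
    (δ : ℝ) (hδ : δ ∈ Set.Ioo 0 (π / 2)) :
    ∃ C > (0 : ℝ), ∃ N : ℕ, ∀ n : ℕ, N ≤ n → ∀ θ ∈ Set.Icc δ (π - δ),
      |Real.sqrt (π * ((n : ℝ) + (α + β + 1) / 2)) *
          (Real.sin (θ / 2)) ^ (α + 1 / 2) * (Real.cos (θ / 2)) ^ (β + 1 / 2) *
          jacobiP α β n (Real.cos θ) -
          Real.cos (((n : ℝ) + (α + β + 1) / 2) * θ - (α / 2 + 1 / 4) * π)| ≤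
        C / ((n : ℝ) + (α + β + 1) / 2) := by
  obtain ⟨C₁, hC₁, N₁, h₁⟩ := exists_abs_sqrt_mul_jacobiP_zero_sub_cos_le hα hβ
  obtain ⟨C₂, hC₂, N₂, h₂⟩ := exists_abs_sqrt_mul_deriv_jacobiP_zero_add_sin_le hα hβ
  set q : ℝ → ℝ := fun θ => (1 / 4 - α ^ 2) / (4 * sin (θ / 2) ^ 2) +
    (1 / 4 - β ^ 2) / (4 * cos (θ / 2) ^ 2) with hq
  have hIoo : Set.Icc δ (π - δ) ⊆ Set.Ioo 0 π := fun θ hθ =>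
    ⟨by linarith [hθ.1, hδ.1], by linarith [hθ.2, hδ.1]⟩
  have hmid : π / 2 ∈ Set.Icc δ (π - δ) := ⟨hδ.2.le, by linarith [hδ.2]⟩
  obtain ⟨Q, hQ⟩ : ∃ Q, ∀ θ ∈ Set.Icc δ (π - δ), |q θ| ≤ Q := by
    suffices h : ContinuousOn q (Set.Icc δ (π - δ)) from
      isCompact_Icc.exists_bound_of_continuousOn h
    intro θ hθ
    have hs : 4 * sin (θ / 2) ^ 2 ≠ 0 := by
      have := sin_pos_of_pos_of_lt_pi (x := θ / 2) (by linarith [(hIoo hθ).1])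
        (by linarith [(hIoo hθ).1, (hIoo hθ).2])
      positivity
    have hc : 4 * cos (θ / 2) ^ 2 ≠ 0 := by
      have := cos_pos_of_mem_Ioo (x := θ / 2)
        ⟨by linarith [(hIoo hθ).1, pi_pos], by linarith [(hIoo hθ).2]⟩
      positivity
    have hsc : ContinuousAt (fun θ => 4 * sin (θ / 2) ^ 2) θ := by fun_prop
    have hcc : ContinuousAt (fun θ => 4 * cos (θ / 2) ^ 2) θ := by fun_prop
    exact ((continuousAt_const.div hsc hs).add
      (continuousAt_const.div hcc hc)).continuousWithinAt
  have hQ0 : 0 ≤ Q := (abs_nonneg _).trans (hQ _ hmid)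
  obtain ⟨N₃, hN₃⟩ := exists_nat_ge (4 * Q)
  refine ⟨4 * Q * (2 + C₁ + C₂) + C₁ + C₂ + 1, by positivity, N₁ + N₂ + N₃ + 2,
    fun n hn θ hθ => ?_⟩
  specialize h₁ n (by omega)
  specialize h₂ n (by omega)
  have hn' : (N₃ : ℝ) + 2 ≤ n := by exact_mod_cast (show N₃ + 2 ≤ n by omega)
  have hN₃0 : (0 : ℝ) ≤ N₃ := N₃.cast_nonneg
  set u : ℝ → ℝ := fun θ => sin (θ / 2) ^ (α + 1 / 2) * cos (θ / 2) ^ (β + 1 / 2) *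
    jacobiP α β n (cos θ) with hu
  obtain ⟨v, huv, hv, hu2, hv2⟩ := exists_hasDerivAt_normal_form α β n (u := u) fun _ => rfl
  rw [mul_assoc, ← hu2] at h₁
  rw [← hv2] at h₂
  set κ : ℝ := n + (α + β + 1) / 2 with hκ
  have hκ1 : 1 ≤ κ := by rw [hκ]; linarith
  have hκ0 : 0 < κ := by linarith
  have hosc := abs_sub_oscillation_le hκ0 (show 4 * Q ≤ κ by rw [hκ]; linarith) hmid
    (fun t ht => abs_le.mpr ⟨by linarith [ht.1, hδ.1, pi_le_four], by
      linarith [ht.2, hδ.1, pi_le_four]⟩) (fun t ht => huv t (hIoo ht))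
    (fun t ht => hv t (hIoo ht)) hQ hθ
  set ν := n * (π / 2) + (β - α) * (π / 4) with hν
  set τ := κ * (θ - π / 2) with hτ
  set r := √(π * κ)
  have hr0 : 0 ≤ r := Real.sqrt_nonneg _
  set X := r * u (π / 2) with hX
  set Y := r * v (π / 2) / κ with hY
  have hXb : |X| ≤ 1 + C₁ := by
    calc |X| = |cos ν + (X - cos ν)| := by congr 1; ring
      _ ≤ |cos ν| + |X - cos ν| := abs_add_le _ _
      _ ≤ 1 + C₁ := add_le_add (abs_cos_le_one _) (h₁.trans (div_le_self hC₁ hκ1))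
  have hYb : |Y| ≤ 1 + C₂ := by
    calc |Y| = |(Y + sin ν) - sin ν| := by congr 1; ring
      _ ≤ |Y + sin ν| + |sin ν| := abs_sub _ _
      _ ≤ C₂ + 1 := add_le_add (h₂.trans (div_le_self hC₂ hκ1)) (abs_sin_le_one _)
      _ = 1 + C₂ := add_comm _ _
  have hrY : r * |v (π / 2)| = κ * |Y| := by
    rw [hY, abs_div, abs_mul, abs_of_nonneg hr0, abs_of_pos hκ0]
    field_simp
  have hrX : r * |u (π / 2)| = |X| := by rw [hX, abs_mul r, abs_of_nonneg hr0]
  have hmain : |r * u θ - (Y * sin τ + X * cos τ)| ≤ 4 * Q / κ * (2 + C₁ + C₂) := by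
    have h3 := mul_le_mul_of_nonneg_left hosc (show 0 ≤ r / κ by positivity)
    rw [← abs_of_nonneg (show 0 ≤ r / κ by positivity), ← abs_mul,
      abs_of_nonneg (show 0 ≤ r / κ by positivity)] at h3
    calc _ = |r / κ * (κ * u θ - (v (π / 2) * sin τ + κ * u (π / 2) * cos τ))| := by
          congr 1
          rw [hX, hY]
          field_simp
      _ ≤ _ := h3
      _ = 4 * Q / κ * ((r * |v (π / 2)|) / κ + r * |u (π / 2)|) := by field_simp
      _ = 4 * Q / κ * (|Y| + |X|) := by rw [hrY, hrX]; field_simp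
      _ ≤ 4 * Q / κ * (1 + C₂ + (1 + C₁)) := by gcongr
      _ = _ := by ring
  have hχ : cos (κ * θ - (α / 2 + 1 / 4) * π) = cos ν * cos τ - sin ν * sin τ := by
    rw [← cos_add, hν, hτ, hκ]
    congr 1
    ring
  rw [hχ]
  calc _ = |(r * u θ - (Y * sin τ + X * cos τ)) + ((Y + sin ν) * sin τ + (X - cos ν) * cos τ)| := by
        simp only [hu]
        congr 1
        ring
    _ ≤ 4 * Q / κ * (2 + C₁ + C₂) + (C₂ / κ * 1 + C₁ / κ * 1) := by
        refine (abs_add_le _ _).trans (add_le_add hmain ((abs_add_le _ _).trans ?_))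
        rw [abs_mul _ (sin τ), abs_mul _ (cos τ)]
        exact add_le_add (mul_le_mul h₂ (abs_sin_le_one _) (abs_nonneg _) (by positivity))
          (mul_le_mul h₁ (abs_cos_le_one _) (abs_nonneg _) (by positivity))
    _ = (4 * Q * (2 + C₁ + C₂) + C₁ + C₂) / κ := by ring
    _ ≤ _ := div_le_div_of_nonneg_right (by linarith) hκ0.le
end

section
/- For all real α, β there exist constants C > 0 and N ∈ ℕ such that for all n ≥ N, writing κ = n + (α+β+1)/2, one has |Γ(n+α+1)/(n! · κ^α) − (1 − αβ/(2κ) − α(α−1)(1+α−3β²)/(24κ²))| ≤ C/κ³. -/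
open Real

open Filter Topology Asymptotics

theorem log_one_add_sub_cubic_isBigO :
    (fun x : ℝ => log (1 + x) - (x - x ^ 2 / 2 + x ^ 3 / 3)) =O[𝓝 0] fun x => x ^ 4 := by
  refine IsBigO.of_bound 2 ?_
  filter_upwards [Metric.ball_mem_nhds (0 : ℝ) (by norm_num : (0 : ℝ) < 1 / 2)] with x hx
  rw [Metric.mem_ball, dist_zero_right, norm_eq_abs] at hx
  have h := abs_log_sub_add_sum_range_le (x := -x) (by rw [abs_neg]; linarith) 3
  rw [abs_neg, sub_neg_eq_add] at h
  have hsum : (∑ i ∈ Finset.range 3, (-x) ^ (i + 1) / ((i : ℝ) + 1)) + log (1 + x)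
      = log (1 + x) - (x - x ^ 2 / 2 + x ^ 3 / 3) := by
    simp only [Finset.sum_range_succ, Finset.sum_range_zero]
    push_cast
    ring
  rw [hsum] at h
  rw [norm_eq_abs, norm_eq_abs, abs_pow]
  refine h.trans ?_
  rw [div_le_iff₀ (by linarith)]
  have h4 := mul_nonneg (pow_nonneg (abs_nonneg x) 4) (sub_nonneg.2 hx.le)
  generalize |x| = t at h4 ⊢
  linear_combination 2 * h4

theorem log_one_add_const_mul_sub_cubic_isBigO (a : ℝ) :
    (fun x : ℝ => log (1 + a * x) - (a * x - (a * x) ^ 2 / 2 + (a * x) ^ 3 / 3))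
      =O[𝓝 0] fun x => x ^ 4 := by
  have ht : Tendsto (fun x : ℝ => a * x) (𝓝 0) (𝓝 0) :=
    (continuous_const_mul a).tendsto' 0 0 (mul_zero a)
  refine (log_one_add_sub_cubic_isBigO.comp_tendsto ht).trans ?_
  exact ((isBigO_refl (fun x : ℝ => x) (𝓝 0)).const_mul_left a).pow 4

/-- Increments of the logarithm of the Gamma quotient, corrected by the first two terms of its
asymptotic expansion, in the variable `h = 1 / κ`. -/
theorem log_increment_isBigO (α β p e : ℝ) (hp : p = -(α * β) / 2)
    (he : e = -(α * (α - 1) * (1 + α - 3 * β ^ 2)) / 24 - p ^ 2 / 2) :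
    (fun h : ℝ => log (1 + (α + 1 - β) / 2 * h) - log (1 + (1 - α - β) / 2 * h)
        - α * log (1 + 1 * h) - p * (h / (1 + h) - h) - e * ((h / (1 + h)) ^ 2 - h ^ 2))
      =O[𝓝 0] fun h => h ^ 4 := by
  have hc : ContinuousAt
      (fun h : ℝ => p / (1 + h) - e * (3 + 2 * h) / (1 + h) ^ 2) 0 := by
    fun_prop (disch := norm_num)
  have hr := (isBigO_refl (fun h : ℝ => h ^ 4) (𝓝 0)).mul (hc.tendsto.isBigO_one ℝ)
  simp only [mul_one] at hr
  refine ((((log_one_add_const_mul_sub_cubic_isBigO ((α + 1 - β) / 2)).sub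
    (log_one_add_const_mul_sub_cubic_isBigO ((1 - α - β) / 2))).sub
    ((log_one_add_const_mul_sub_cubic_isBigO 1).const_mul_left α)).add hr).congr' ?_ .rfl
  filter_upwards [Metric.ball_mem_nhds (0 : ℝ) one_pos] with h hh
  rw [Metric.mem_ball, dist_zero_right, norm_eq_abs, abs_lt] at hh
  have h1 : 1 + h ≠ 0 := by linarith
  have e1 : h / (1 + h) - h = -h ^ 2 + h ^ 3 - h ^ 4 / (1 + h) := by
    field_simp
    ring
  have e2 : (h / (1 + h)) ^ 2 - h ^ 2
      = -2 * h ^ 3 + h ^ 4 * (3 + 2 * h) / (1 + h) ^ 2 := by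
    field_simp
    ring
  rw [e1, e2, he, hp]
  ring

theorem inv_pow_four_le_telescope {x : ℝ} (hx : 1 ≤ x) :
    x⁻¹ ^ 4 ≤ 3 * (x⁻¹ ^ 3 - (x + 1)⁻¹ ^ 3) := by
  have h0 : 0 < x := by linarith
  have key : 3 * (x⁻¹ ^ 3 - (x + 1)⁻¹ ^ 3) - x⁻¹ ^ 4
      = (8 * x ^ 3 + 6 * x ^ 2 - 1) / (x ^ 4 * (x + 1) ^ 3) := by
    field_simp
    ring
  have : 0 ≤ (8 * x ^ 3 + 6 * x ^ 2 - 1) / (x ^ 4 * (x + 1) ^ 3) := by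
    apply div_nonneg _ (by positivity)
    nlinarith [pow_pos h0 3]
  linarith

theorem tendsto_inv_natCast_add (γ : ℝ) :
    Tendsto (fun n : ℕ => ((n : ℝ) + γ)⁻¹) atTop (𝓝 0) :=
  tendsto_inv_atTop_zero.comp (tendsto_atTop_add_const_right _ γ tendsto_natCast_atTop_atTop)

theorem isBigO_inv_cube_of_increment_isBigO {L : ℕ → ℝ} (γ : ℝ) (hL : Tendsto L atTop (𝓝 0))
    (hinc : (fun n => L (n + 1) - L n) =O[atTop] fun n : ℕ => ((n : ℝ) + γ)⁻¹ ^ 4) :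
    L =O[atTop] fun n : ℕ => ((n : ℝ) + γ)⁻¹ ^ 3 := by
  obtain ⟨C, hC, hb⟩ := hinc.exists_pos
  have hge : ∀ᶠ n : ℕ in atTop, 1 ≤ (n : ℝ) + γ :=
    (tendsto_atTop_add_const_right _ γ tendsto_natCast_atTop_atTop).eventually_ge_atTop 1
  obtain ⟨N, hN⟩ := eventually_atTop.1 (hb.bound.and hge)
  set g : ℕ → ℝ := fun n => 3 * C * ((n : ℝ) + γ)⁻¹ ^ 3 with hg
  have hg0 : Tendsto g atTop (𝓝 0) := by
    simpa [hg] using ((tendsto_inv_natCast_add γ).pow 3).const_mul (3 * C)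
  have hstep : ∀ n, N ≤ n → |L (n + 1) - L n| ≤ g n - g (n + 1) := by
    intro n hn
    obtain ⟨h1, h2⟩ := hN n hn
    rw [norm_eq_abs, norm_eq_abs, abs_of_nonneg (a := _ ^ 4) (by positivity)] at h1
    have h3 := mul_le_mul_of_nonneg_left (inv_pow_four_le_telescope h2) hC.le
    simp only [hg]
    push_cast
    rw [show (n : ℝ) + 1 + γ = n + γ + 1 by ring]
    linarith
  have hanti : Antitone fun k => L (k + N) + g (k + N) := by
    refine antitone_nat_of_succ_le fun k => ?_
    have := (abs_le.1 (hstep (k + N) (Nat.le_add_left _ _))).2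
    rw [show k + 1 + N = k + N + 1 by ring]
    linarith
  have hmono : Monotone fun k => L (k + N) - g (k + N) := by
    refine monotone_nat_of_le_succ fun k => ?_
    have := (abs_le.1 (hstep (k + N) (Nat.le_add_left _ _))).1
    rw [show k + 1 + N = k + N + 1 by ring]
    linarith
  have hl1 : Tendsto (fun k => L (k + N) + g (k + N)) atTop (𝓝 0) := by
    simpa [Function.comp_def] using (hL.add hg0).comp (tendsto_add_atTop_nat N)
  have hl2 : Tendsto (fun k => L (k + N) - g (k + N)) atTop (𝓝 0) := by
    simpa [Function.comp_def] using (hL.sub hg0).comp (tendsto_add_atTop_nat N)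
  refine IsBigO.of_bound (3 * C) ?_
  filter_upwards [eventually_ge_atTop N] with n hn
  obtain ⟨k, rfl⟩ := Nat.exists_eq_add_of_le' hn
  have h1 := hanti.le_of_tendsto hl1 k
  have h2 := hmono.ge_of_tendsto hl2 k
  have h3 := (hN (k + N) hn).2
  rw [norm_eq_abs, norm_eq_abs, abs_of_nonneg (a := _ ^ 3) (by positivity), abs_le]
  simp only [hg] at h1 h2
  constructor <;> linarith

theorem prod_range_add_mul_Gamma {s : ℝ} (hs : 0 < s) (n : ℕ) :
    (∏ j ∈ Finset.range n, (s + j)) * Gamma s = Gamma (n + s) := by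
  induction n with
  | zero => simp
  | succ n ih =>
    have h : (n : ℝ) + s ≠ 0 := by positivity
    rw [Finset.prod_range_succ, mul_right_comm, ih]
    push_cast
    rw [add_right_comm, Gamma_add_one h]
    ring

theorem tendsto_Gamma_ratio_of_pos {s : ℝ} (hs : 0 < s) :
    Tendsto (fun n : ℕ => Gamma (n + s + 1) / (n.factorial * (n : ℝ) ^ s)) atTop (𝓝 1) := by
  have hG := (Gamma_pos_of_pos hs).ne'
  have h := (GammaSeq_tendsto_Gamma s).inv₀ hG |>.const_mul (Gamma s)
  rw [mul_inv_cancel₀ hG] at h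
  refine h.congr fun n => ?_
  have hp := prod_range_add_mul_Gamma hs (n + 1)
  push_cast at hp
  rw [add_right_comm] at hp
  rw [← hp, GammaSeq, inv_div]
  ring

theorem tendsto_Gamma_ratio (s : ℝ) :
    Tendsto (fun n : ℕ => Gamma (n + s + 1) / (n.factorial * (n : ℝ) ^ s)) atTop (𝓝 1) := by
  obtain ⟨k, hk⟩ := exists_nat_gt (-s)
  induction k generalizing s with
  | zero => exact tendsto_Gamma_ratio_of_pos (by simpa using hk)
  | succ k ih =>
    have h := ih (s + 1) (by push_cast at hk; linarith)
    have hq : Tendsto (fun n : ℕ => 1 - (s + 1) * ((n : ℝ) + (s + 1))⁻¹) atTop (𝓝 1) := by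
      simpa using ((tendsto_inv_natCast_add (s + 1)).const_mul (s + 1)).const_sub 1
    have := h.mul hq
    rw [mul_one] at this
    refine this.congr' ?_
    filter_upwards [eventually_gt_atTop 0,
      (tendsto_atTop_add_const_right _ (s + 1)
        tendsto_natCast_atTop_atTop).eventually_gt_atTop 0] with n hn hpos
    have hn' : (0 : ℝ) < n := by exact_mod_cast hn
    have hpos' : (n : ℝ) + s + 1 ≠ 0 := by linarith
    rw [← add_assoc, Gamma_add_one hpos', rpow_add hn', rpow_one]
    have h1 : (n : ℝ) ^ s ≠ 0 := (rpow_pos_of_pos hn' s).ne'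
    have h2 : (n.factorial : ℝ) ≠ 0 := by positivity
    field_simp
    ring

theorem tendsto_Gamma_ratio_shifted (α γ : ℝ) :
    Tendsto (fun n : ℕ => Gamma (n + α + 1) / (n.factorial * ((n : ℝ) + γ) ^ α))
      atTop (𝓝 1) := by
  have hq : Tendsto (fun n : ℕ => (1 - γ * ((n : ℝ) + γ)⁻¹) ^ α) atTop (𝓝 1) := by
    have h1 : Tendsto (fun n : ℕ => 1 - γ * ((n : ℝ) + γ)⁻¹) atTop (𝓝 1) := by
      simpa using ((tendsto_inv_natCast_add γ).const_mul γ).const_sub 1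
    simpa using h1.rpow_const (p := α) (Or.inl one_ne_zero)
  have h := (tendsto_Gamma_ratio α).mul hq
  rw [mul_one] at h
  refine h.congr' ?_
  filter_upwards [eventually_gt_atTop 0, (tendsto_atTop_add_const_right _ γ
    tendsto_natCast_atTop_atTop).eventually_gt_atTop 0] with n hn hpos
  have hn' : (0 : ℝ) < n := by exact_mod_cast hn
  have e1 : 1 - γ * ((n : ℝ) + γ)⁻¹ = n / (n + γ) := by
    field_simp
    ring
  have h1 : (n : ℝ) ^ α ≠ 0 := (rpow_pos_of_pos hn' α).ne'
  have h2 : ((n : ℝ) + γ) ^ α ≠ 0 := (rpow_pos_of_pos hpos α).ne'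
  have h3 : (n.factorial : ℝ) ≠ 0 := by positivity
  rw [e1, div_rpow hn'.le hpos.le]
  field_simp

/-- The ratio of the front factors at `n + 1` and `n`. -/
theorem log_Gamma_ratio_succ_sub {α γ : ℝ} {n : ℕ} (hn : 0 < (n : ℝ) + α + 1)
    (hγ : 0 < (n : ℝ) + γ) :
    log (Gamma ((n + 1 : ℕ) + α + 1) / ((n + 1).factorial * (((n + 1 : ℕ) : ℝ) + γ) ^ α))
        - log (Gamma (n + α + 1) / (n.factorial * ((n : ℝ) + γ) ^ α))
      = log (1 + (α + 1 - γ) * ((n : ℝ) + γ)⁻¹) - log (1 + (1 - γ) * ((n : ℝ) + γ)⁻¹)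
        - α * log (1 + 1 * ((n : ℝ) + γ)⁻¹) := by
  have hG := Gamma_pos_of_pos hn
  have hf : (n.factorial : ℝ) ≠ 0 := by positivity
  have hn1 : (0 : ℝ) < n + 1 := by positivity
  have hγ1 : (0 : ℝ) < n + γ + 1 := by linarith
  have e1 : 1 + (α + 1 - γ) * ((n : ℝ) + γ)⁻¹ = (n + α + 1) / (n + γ) := by
    field_simp; ring
  have e2 : 1 + (1 - γ) * ((n : ℝ) + γ)⁻¹ = (n + 1) / (n + γ) := by
    field_simp; ring
  have e3 : 1 + 1 * ((n : ℝ) + γ)⁻¹ = (n + γ + 1) / (n + γ) := by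
    field_simp
  rw [e1, e2, e3, Nat.factorial_succ]
  push_cast
  rw [show (n : ℝ) + 1 + α + 1 = n + α + 1 + 1 by ring, Gamma_add_one hn.ne',
    show (n : ℝ) + 1 + γ = n + γ + 1 by ring]
  have p1 := rpow_pos_of_pos hγ α
  have p2 := rpow_pos_of_pos hγ1 α
  rw [log_div (by positivity) (by positivity), log_div (by positivity) (by positivity),
    log_mul hn.ne' hG.ne', log_mul (by positivity) p2.ne', log_mul hn1.ne' hf,
    log_mul hf p1.ne', log_rpow hγ, log_rpow hγ1, log_div hn.ne' hγ.ne',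
    log_div hn1.ne' hγ.ne', log_div hγ1.ne' hγ.ne']
  ring

/-- Exponentiating a second order expansion. -/
theorem exp_sub_quadratic_isBigO {ι : Type*} {l : Filter ι} {y h : ι → ℝ} (p e : ℝ)
    (hh : Tendsto h l (𝓝 0))
    (hy : (fun n => y n - p * h n - e * h n ^ 2) =O[l] fun n => h n ^ 3) :
    (fun n => exp (y n) - (1 + p * h n + (e + p ^ 2 / 2) * h n ^ 2))
      =O[l] fun n => h n ^ 3 := by
  have hpow : ∀ i : ℕ, (fun n => h n ^ (i + 1)) =O[l] fun n => h n ^ i := fun i => by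
    simpa only [mul_one, ← pow_succ] using
      (isBigO_refl (fun n => h n ^ i) l).mul (hh.isBigO_one ℝ)
  have hy2 : (fun n => y n - p * h n) =O[l] fun n => h n ^ 2 :=
    ((hy.trans (hpow 2)).add
      ((isBigO_refl (fun n => h n ^ 2) l).const_mul_left e)).congr_left fun n => by ring
  have hlin : (fun n => p * h n) =O[l] h := (isBigO_refl h l).const_mul_left p
  have hy1 : y =O[l] h :=
    ((hy2.trans ((hpow 1).congr_right fun n => pow_one _)).add
      hlin).congr_left fun n => by ring
  have hexp : (fun n => exp (y n) - ∑ i ∈ Finset.range 3, y n ^ i / (i.factorial : ℝ))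
      =O[l] fun n => h n ^ 3 :=
    ((exp_sub_sum_range_isBigO_pow 3).comp_tendsto (hy1.trans_tendsto hh)).trans (hy1.pow 3)
  have hsq : (fun n => (y n - p * h n) * (y n + p * h n)) =O[l] fun n => h n ^ 3 :=
    (hy2.mul (hy1.add hlin)).congr_right fun n => by ring
  refine ((hexp.add hy).add (hsq.const_mul_left (1 / 2))).congr_left fun n => ?_
  simp only [Finset.sum_range_succ, Finset.sum_range_zero, Nat.factorial]
  push_cast
  ring

theorem gamma_ratio_front_factor_expansion (α β : ℝ) :
    ∃ C > (0 : ℝ), ∃ N : ℕ, ∀ n : ℕ, N ≤ n →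
      let κ := (n : ℝ) + (α + β + 1) / 2
      |Real.Gamma ((n : ℝ) + α + 1) / ((Nat.factorial n : ℝ) * κ ^ α) -
          (1 - α * β / (2 * κ) -
            α * (α - 1) * (1 + α - 3 * β ^ 2) / (24 * κ ^ 2))| ≤ C / κ ^ 3 := by
  set γ := (α + β + 1) / 2 with hγ
  obtain ⟨p, hp⟩ : ∃ p, p = -(α * β) / 2 := ⟨_, rfl⟩
  obtain ⟨e, he⟩ : ∃ e, e = -(α * (α - 1) * (1 + α - 3 * β ^ 2)) / 24 - p ^ 2 / 2 := ⟨_, rfl⟩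
  set F : ℕ → ℝ := fun n => Gamma (n + α + 1) / (n.factorial * ((n : ℝ) + γ) ^ α) with hF
  set h : ℕ → ℝ := fun n => ((n : ℝ) + γ)⁻¹ with hh
  have hh0 : Tendsto h atTop (𝓝 0) := tendsto_inv_natCast_add γ
  have hpos : ∀ c : ℝ, ∀ᶠ n : ℕ in atTop, 0 < (n : ℝ) + c := fun c =>
    (tendsto_atTop_add_const_right _ c tendsto_natCast_atTop_atTop).eventually_gt_atTop 0
  have hlim : Tendsto (fun n => log (F n) - p * h n - e * h n ^ 2) atTop (𝓝 0) := by
    have h1 := (tendsto_Gamma_ratio_shifted α γ).log one_ne_zero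
    simpa using (h1.sub (hh0.const_mul p)).sub ((hh0.pow 2).const_mul e)
  have hlog : (fun n => log (F n) - p * h n - e * h n ^ 2) =O[atTop] fun n => h n ^ 3 := by
    refine isBigO_inv_cube_of_increment_isBigO γ hlim ?_
    refine ((log_increment_isBigO α β p e hp he).comp_tendsto hh0).congr' ?_ .rfl
    filter_upwards [hpos γ, hpos (α + 1)] with n hn1 hn2
    have hs := log_Gamma_ratio_succ_sub (α := α) (by linarith) hn1
    rw [show α + 1 - γ = (α + 1 - β) / 2 by rw [hγ]; ring,
      show 1 - γ = (1 - α - β) / 2 by rw [hγ]; ring] at hs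
    have hsucc : h (n + 1) = h n / (1 + h n) := by
      simp only [hh]
      push_cast
      have : (n : ℝ) + 1 + γ ≠ 0 := by linarith
      have : (n : ℝ) + γ + 1 ≠ 0 := by linarith
      field_simp
      ring
    simp only [Function.comp_apply, ← hsucc]
    linarith
  obtain ⟨C, hC, hb⟩ := (exp_sub_quadratic_isBigO p e hh0 hlog).exists_pos
  obtain ⟨N, hN⟩ := eventually_atTop.1 (hb.bound.and ((hpos γ).and (hpos (α + 1))))
  refine ⟨C, hC, N, fun n hn => ?_⟩
  obtain ⟨h1, h2, h3⟩ := hN n hn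
  have hFpos : 0 < F n := by
    have := Gamma_pos_of_pos (show 0 < (n : ℝ) + α + 1 by linarith)
    have := rpow_pos_of_pos h2 α
    positivity
  rw [exp_log hFpos, norm_eq_abs, norm_eq_abs, abs_of_nonneg (a := _ ^ 3) (by positivity)] at h1
  have hquad : 1 + p * h n + (e + p ^ 2 / 2) * h n ^ 2
      = 1 - α * β / (2 * ((n : ℝ) + γ))
        - α * (α - 1) * (1 + α - 3 * β ^ 2) / (24 * ((n : ℝ) + γ) ^ 2) := by
    rw [he, hp]
    simp only [hh]
    field_simp
    ring
  rw [hquad] at h1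
  simpa only [hF, hh, inv_pow, ← div_eq_mul_inv] using h1
end
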